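/- Let f : K² → K (K = ℝ or ℂ) be a polynomial of degree d ≥ 1 with f(0) = 0. Then the Łojasiewicz gradient exponent of f at the origin satisfies ℒ(f) ≤ 1 - 1/((d-1)² + 1). -/

import Mathlib

noncomputable def LGE {𝕜 : Type*} [RCLike 𝕜] {E : Type*} [NormedAddCommGroup E]
    [NormedSpace 𝕜 E] (f : E → 𝕜) : ℝ :=
  sInf {l : ℝ | 0 < l ∧ ∃ c > (0:ℝ), ∃ ε > (0:ℝ), ∀ z : E, ‖z‖ < ε →
    c * ‖f z‖ ^ l ≤ ‖fderiv 𝕜 f z‖}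

section
open Polynomial Filter Topology Asymptotics

/-- An analytic germ in one variable is either zero or, together with its Euler derivative,
a power of the variable times an explicit factor. -/
lemma AnalyticAt.eventually_zero_or_exists_pow_mul {c : ℂ → ℂ} (hc : AnalyticAt ℂ c 0) :
    (∀ᶠ t in 𝓝 0, c t = 0 ∧ t * deriv c t = 0) ∨
      ∃ (m : ℕ) (g : ℂ → ℂ), AnalyticAt ℂ g 0 ∧ g 0 ≠ 0 ∧
        ∀ᶠ t in 𝓝 0, c t = t ^ m * g t ∧ t * deriv c t = t ^ m * (m * g t + t * deriv g t) := by
  by_cases h0 : ∀ᶠ t in 𝓝 0, c t = 0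
  · left
    filter_upwards [h0, h0.eventually_nhds] with t h1 ht
    have : c =ᶠ[𝓝 t] fun _ => 0 := ht
    exact ⟨h1, by rw [this.deriv_eq]; simp⟩
  · right
    have hne : analyticOrderAt c 0 ≠ ⊤ := by rwa [ne_eq, analyticOrderAt_eq_top]
    obtain ⟨g, hg, hg0, hcg⟩ := hc.analyticOrderAt_ne_top.1 hne
    refine ⟨analyticOrderNatAt c 0, g, hg, hg0, ?_⟩
    filter_upwards [hcg, hcg.eventually_nhds, hg.eventually_analyticAt] with t h1 h2 h3
    generalize analyticOrderNatAt c 0 = m at *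
    have h2' : c =ᶠ[𝓝 t] fun z => z ^ m * g z := by
      filter_upwards [h2] with z hz
      simpa using hz
    refine ⟨by simpa using h1, ?_⟩
    rw [h2'.deriv_eq, ((hasDerivAt_pow m t).fun_mul h3.differentiableAt.hasDerivAt).deriv]
    rcases m with _ | m
    · simp
    · push_cast
      ring

/-- An analytic germ dominates its Euler derivative. -/
lemma AnalyticAt.id_mul_deriv_isBigO {c : ℂ → ℂ} (hc : AnalyticAt ℂ c 0) :
    (fun t => t * deriv c t) =O[𝓝 0] c := by
  rcases hc.eventually_zero_or_exists_pow_mul with h | ⟨m, g, hg, hg0, h⟩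
  · exact IsBigO.of_bound 1 (by filter_upwards [h] with t ht; simp [ht.1, ht.2])
  · refine IsBigO.congr' ?_ (h.mono fun t ht => ht.2.symm) (h.mono fun t ht => ht.1.symm)
    refine (isBigO_refl _ _).mul ?_
    have hcont : ContinuousAt (fun t => m * g t + t * deriv g t) 0 :=
      (continuousAt_const.mul hg.continuousAt).add (continuousAt_id.mul hg.deriv.continuousAt)
    refine (hcont.tendsto.isBigO_one ℂ).trans ?_
    exact (isBigO_const_left_iff_pos_le_norm one_ne_zero).2
      ⟨‖g 0‖ / 2, by positivity, (hg.continuousAt.norm.eventually_const_le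
        (half_lt_self (norm_pos_iff.2 hg0)))⟩

/-- An analytic germ vanishing at the origin is dominated by its Euler derivative. -/
lemma AnalyticAt.isBigO_id_mul_deriv {c : ℂ → ℂ} (hc : AnalyticAt ℂ c 0) (hc0 : c 0 = 0) :
    c =O[𝓝 0] (fun t => t * deriv c t) := by
  rcases hc.eventually_zero_or_exists_pow_mul with h | ⟨m, g, hg, hg0, h⟩
  · exact IsBigO.of_bound 1 (by filter_upwards [h] with t ht; simp [ht.1, ht.2])
  · refine IsBigO.congr' ?_ (h.mono fun t ht => ht.1.symm) (h.mono fun t ht => ht.2.symm)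
    refine (isBigO_refl _ _).mul ?_
    have hm : (m : ℂ) ≠ 0 := by
      rintro hm
      have := h.self_of_nhds.1
      simp [Nat.cast_eq_zero.1 hm, hc0] at this
      exact hg0 this.symm
    have hcont : ContinuousAt (fun t => m * g t + t * deriv g t) 0 :=
      (continuousAt_const.mul hg.continuousAt).add (continuousAt_id.mul hg.deriv.continuousAt)
    have hpos : 0 < ‖(m : ℂ) * g 0 + 0 * deriv g 0‖ := by
      simpa [hg0] using Nat.pos_of_ne_zero (Nat.cast_ne_zero.1 hm)
    refine (hg.continuousAt.tendsto.isBigO_one ℂ).trans ?_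
    exact (isBigO_const_left_iff_pos_le_norm one_ne_zero).2
      ⟨_, half_pos hpos, hcont.norm.eventually_const_le (half_lt_self hpos)⟩

/-- Monic polynomials of degree `n` depending on a parameter, with coefficients analytic at `0`. -/
structure IsMonicAnalyticFamily (n : ℕ) (p : ℂ → ℂ[X]) : Prop where
  monic : ∀ t, (p t).Monic
  natDegree_eq : ∀ t, (p t).natDegree = n
  analyticAt_coeff : ∀ k, AnalyticAt ℂ (fun t => (p t).coeff k) 0

lemma coeff_X_pow_add_ofFn (n : ℕ) (u : Fin n → ℂ) (k : ℕ) :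
    (X ^ n + ofFn n u : ℂ[X]).coeff k =
      if h : k < n then u ⟨k, h⟩ else if k = n then 1 else 0 := by
  rw [coeff_add, coeff_X_pow]
  split_ifs <;> simp_all
  omega

lemma isMonicAnalyticFamily_X_pow_add_ofFn {n : ℕ} {u : ℂ → Fin n → ℂ} (hu : AnalyticAt ℂ u 0) :
    IsMonicAnalyticFamily n (fun t => X ^ n + ofFn n (u t)) where
  monic t := monic_X_pow_add (ofFn_degree_lt _)
  natDegree_eq t := natDegree_eq_of_degree_eq_some
    (by rw [degree_add_eq_left_of_degree_lt] <;> simp [ofFn_degree_lt])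
  analyticAt_coeff k := by
    simp only [coeff_X_pow_add_ofFn]
    split_ifs with h1 h2
    · exact (analyticAt_pi_iff.1 hu) _
    · exact analyticAt_const
    · exact analyticAt_const

lemma Polynomial.Monic.eq_X_pow_add_ofFn {p : ℂ[X]} (hp : p.Monic) {n : ℕ} (hn : p.natDegree = n) :
    p = X ^ n + ofFn n (fun i => p.coeff i) := by
  ext k
  rw [coeff_X_pow_add_ofFn]
  split_ifs with h1 h2
  · rfl
  · rw [h2, ← hn]; exact hp
  · exact coeff_eq_zero_of_natDegree_lt (by omega)

/-- The coefficients of the product of two monic polynomials, as a function of their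
non-leading coefficients. -/
noncomputable def monicMulCoeff (a b : ℕ) (x : (Fin a → ℂ) × (Fin b → ℂ)) : Fin (a + b) → ℂ :=
  fun i => ((X ^ a + ofFn a x.1) * (X ^ b + ofFn b x.2) : ℂ[X]).coeff i

lemma X_pow_add_ofFn_monicMulCoeff (a b : ℕ) (x : (Fin a → ℂ) × (Fin b → ℂ)) :
    (X ^ (a + b) + ofFn (a + b) (monicMulCoeff a b x) : ℂ[X]) =
      (X ^ a + ofFn a x.1) * (X ^ b + ofFn b x.2) := by
  have h1 : (X ^ a + ofFn a x.1 : ℂ[X]).Monic := monic_X_pow_add (ofFn_degree_lt _)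
  have h2 : (X ^ b + ofFn b x.2 : ℂ[X]).Monic := monic_X_pow_add (ofFn_degree_lt _)
  refine ((h1.mul h2).eq_X_pow_add_ofFn ?_).symm
  rw [h1.natDegree_mul h2]
  congr 1 <;> refine natDegree_eq_of_degree_eq_some ?_ <;>
    rw [degree_add_eq_left_of_degree_lt] <;> simp [ofFn_degree_lt]

lemma contDiff_monicMulCoeff (a b : ℕ) : ContDiff ℂ 1 (monicMulCoeff a b) := by
  refine contDiff_pi.2 fun i => ?_
  simp only [monicMulCoeff, coeff_mul, coeff_X_pow_add_ofFn]
  refine ContDiff.sum fun j _ => ContDiff.mul ?_ ?_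
  all_goals split_ifs <;> fun_prop

lemma hasDerivAt_monicMulCoeff_line (a b : ℕ) (x y : (Fin a → ℂ) × (Fin b → ℂ)) :
    HasDerivAt (fun s : ℂ => monicMulCoeff a b (x + s • y))
      (fun i : Fin (a + b) => (ofFn a y.1 * (X ^ b + ofFn b x.2) +
        (X ^ a + ofFn a x.1) * ofFn b y.2 : ℂ[X]).coeff i) 0 := by
  refine hasDerivAt_pi.2 fun i => ?_
  have key : ∀ s : ℂ, monicMulCoeff a b (x + s • y) i =
      ((X ^ a + ofFn a x.1) * (X ^ b + ofFn b x.2) : ℂ[X]).coeff i +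
      s * (ofFn a y.1 * (X ^ b + ofFn b x.2) + (X ^ a + ofFn a x.1) * ofFn b y.2 : ℂ[X]).coeff i +
      s ^ 2 * (ofFn a y.1 * ofFn b y.2 : ℂ[X]).coeff i := by
    intro s
    simp only [monicMulCoeff, Prod.fst_add, Prod.snd_add, Prod.smul_fst, Prod.smul_snd, map_add,
      map_smul, ← coeff_C_mul, ← coeff_add, smul_eq_C_mul]
    congr 1
    rw [map_pow]
    ring
  simp only [key]
  have h := (((hasDerivAt_const (0:ℂ)
    (((X ^ a + ofFn a x.1) * (X ^ b + ofFn b x.2) : ℂ[X]).coeff i)).add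
    ((hasDerivAt_id (0:ℂ)).mul_const
      ((ofFn a y.1 * (X ^ b + ofFn b x.2) + (X ^ a + ofFn a x.1) * ofFn b y.2 : ℂ[X]).coeff i))).add
    (((hasDerivAt_id (0:ℂ)).pow 2).mul_const ((ofFn a y.1 * ofFn b y.2 : ℂ[X]).coeff i)))
  refine h.congr_deriv ?_
  simp

/-- A factorization into coprime monic factors at the origin extends analytically. -/
lemma IsMonicAnalyticFamily.exists_factorization {a b : ℕ} {p : ℂ → ℂ[X]}
    (hp : IsMonicAnalyticFamily (a + b) p) {g h : ℂ[X]} (hg : g.Monic) (hh : h.Monic)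
    (hga : g.natDegree = a) (hhb : h.natDegree = b) (hcop : IsCoprime g h) (h0 : p 0 = g * h) :
    ∃ q r : ℂ → ℂ[X], IsMonicAnalyticFamily a q ∧ IsMonicAnalyticFamily b r ∧
      ∀ᶠ t in 𝓝 0, p t = q t * r t := by
  set x : (Fin a → ℂ) × (Fin b → ℂ) := (fun i => g.coeff i, fun i => h.coeff i) with hx
  have hgx := hg.eq_X_pow_add_ofFn hga
  have hhx := hh.eq_X_pow_add_ofFn hhb
  have hcd : ContDiffAt ℂ 1 (monicMulCoeff a b) x := (contDiff_monicMulCoeff a b).contDiffAt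
  have hd := (hcd.differentiableAt one_ne_zero).hasFDerivAt
  set L := fderiv ℂ (monicMulCoeff a b) x
  have hL : ∀ y, L y = fun i : Fin (a + b) => (ofFn a y.1 * h + g * ofFn b y.2 : ℂ[X]).coeff i := by
    intro y
    have h1 : HasDerivAt (fun s : ℂ => x + s • y) y 0 := by
      simpa using ((hasDerivAt_id (0:ℂ)).smul_const y).const_add x
    have h2 := HasFDerivAt.comp_hasDerivAt (x := (0:ℂ)) (f := fun s : ℂ => x + s • y)
      (l := monicMulCoeff a b) (l' := L) (by simpa using hd) h1
    have := h2.unique (hasDerivAt_monicMulCoeff_line a b x y)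
    rw [this]
    simp only [hx, ← hgx, ← hhx]
  have hinj : Function.Injective L := by
    rw [injective_iff_map_eq_zero]
    intro y hy
    rw [hL] at hy
    have hdeg : (ofFn a y.1 * h + g * ofFn b y.2 : ℂ[X]) = 0 := by
      ext k
      by_cases hk : k < a + b
      · exact congrFun hy ⟨k, hk⟩
      · rw [coeff_zero]
        refine coeff_eq_zero_of_degree_lt (lt_of_lt_of_le ?_ (Nat.cast_le.2 (not_lt.1 hk)))
        refine (degree_add_le _ _).trans_lt (max_lt ?_ ?_)
        · rw [degree_mul, degree_eq_natDegree hh.ne_zero, hhb]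
          push_cast
          exact WithBot.add_lt_add_right (by simp) (ofFn_degree_lt _)
        · rw [degree_mul, degree_eq_natDegree hg.ne_zero, hga]
          push_cast
          exact WithBot.add_lt_add_left (by simp) (ofFn_degree_lt _)
    have hdvd : g ∣ ofFn a y.1 := hcop.dvd_of_dvd_mul_right
      ⟨-ofFn b y.2, by linear_combination hdeg⟩
    have hy1 : ofFn a y.1 = 0 := eq_zero_of_dvd_of_degree_lt hdvd
      (by rw [degree_eq_natDegree hg.ne_zero, hga]; exact ofFn_degree_lt _)
    have hy2 : ofFn b y.2 = 0 := by
      rw [hy1, zero_mul, zero_add, mul_eq_zero] at hdeg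
      exact hdeg.resolve_left hg.ne_zero
    exact Prod.ext (injective_ofFn a (by simpa using hy1)) (injective_ofFn b (by simpa using hy2))
  let e := (LinearMap.linearEquivOfInjective (f := L.toLinearMap) hinj
    (by simp)).toContinuousLinearEquiv
  have he : (e : _ →L[ℂ] _) = L := ContinuousLinearMap.ext fun y => rfl
  have hd' : HasFDerivAt (monicMulCoeff a b) (e : _ →L[ℂ] _) x := by rwa [he]
  set φ := hcd.localInverse hd' one_ne_zero with hφ
  have hφd : ContDiffAt ℂ 1 φ (monicMulCoeff a b x) := hcd.to_localInverse hd' one_ne_zero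
  have hφr : ∀ᶠ v in 𝓝 (monicMulCoeff a b x), monicMulCoeff a b (φ v) = v :=
    (hcd.hasStrictFDerivAt' hd' one_ne_zero).eventually_right_inverse
  set u : ℂ → Fin (a + b) → ℂ := fun t i => (p t).coeff i with hu
  have hua : AnalyticAt ℂ u 0 := analyticAt_pi_iff.2 fun i => hp.analyticAt_coeff i
  have hu0 : u 0 = monicMulCoeff a b x := by
    funext i
    simp only [hu, monicMulCoeff, hx, ← hgx, ← hhx, h0]
  have hφa : AnalyticAt ℂ (fun t => φ (u t)) 0 := by
    refine Complex.analyticAt_iff_eventually_differentiableAt.2 ?_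
    have h1 : ∀ᶠ v in 𝓝 (u 0), DifferentiableAt ℂ φ v := by
      rw [hu0]
      exact (hφd.eventually (by simp)).mono fun v hv => hv.differentiableAt one_ne_zero
    filter_upwards [hua.continuousAt.eventually h1, hua.eventually_analyticAt] with t h1 h2
    exact h1.comp t h2.differentiableAt
  refine ⟨_, _, isMonicAnalyticFamily_X_pow_add_ofFn (analyticAt_fst.comp hφa),
    isMonicAnalyticFamily_X_pow_add_ofFn (analyticAt_snd.comp hφa), ?_⟩
  rw [← hu0] at hφr
  filter_upwards [hua.continuousAt.eventually hφr] with t ht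
  rw [(hp.monic t).eq_X_pow_add_ofFn (hp.natDegree_eq t)]
  change (X ^ (a + b) + ofFn (a + b) (u t) : ℂ[X]) = _
  rw [← ht, X_pow_add_ofFn_monicMulCoeff]
  rfl

lemma analyticAt_taylor_coeff {n : ℕ} {p : ℂ → ℂ[X]} {α : ℂ → ℂ} (hn : ∀ t, (p t).natDegree ≤ n)
    (hp : ∀ k, AnalyticAt ℂ (fun t => (p t).coeff k) 0) (hα : AnalyticAt ℂ α 0) (k : ℕ) :
    AnalyticAt ℂ (fun t => (taylor (α t) (p t)).coeff k) 0 := by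
  have : ∀ t, (taylor (α t) (p t)).coeff k =
      ∑ i ∈ Finset.range (n + 1), ((i + k).choose k : ℂ) * (p t).coeff (i + k) * α t ^ i := by
    intro t
    rw [taylor_coeff, eval_eq_sum_range' (n := n + 1)]
    · simp only [hasseDeriv_coeff]
    · have := natDegree_hasseDeriv_le (p t) k
      have := hn t
      omega
  simp only [this]
  refine Finset.analyticAt_fun_sum _ fun i _ => ?_
  exact (analyticAt_const.mul (hp _)).mul (hα.pow i)

/-- After a ramified change of parameter the family splits into analytic linear factors. -/
def HasPuiseuxRoots (p : ℂ → ℂ[X]) : Prop :=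
  ∃ N : ℕ, N ≠ 0 ∧ ∃ s : List (ℂ → ℂ), (∀ γ ∈ s, AnalyticAt ℂ γ 0) ∧
    ∀ᶠ t in 𝓝 0, p (t ^ N) = (s.map fun γ => X - C (γ t)).prod

lemma tendsto_pow_nhds_zero {N : ℕ} (hN : N ≠ 0) : Tendsto (fun t : ℂ => t ^ N) (𝓝 0) (𝓝 0) := by
  simpa [hN] using (continuous_pow (M := ℂ) N).tendsto 0

lemma AnalyticAt.comp_pow {γ : ℂ → ℂ} (hγ : AnalyticAt ℂ γ 0) {N : ℕ} (hN : N ≠ 0) :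
    AnalyticAt ℂ (fun t => γ (t ^ N)) 0 :=
  AnalyticAt.comp_of_eq (f := fun t : ℂ => t ^ N) hγ (analyticAt_id.pow N) (by simp [hN])

lemma HasPuiseuxRoots.of_comp_pow {p : ℂ → ℂ[X]} {N : ℕ} (hN : N ≠ 0)
    (h : HasPuiseuxRoots fun t => p (t ^ N)) : HasPuiseuxRoots p := by
  obtain ⟨M, hM, s, hs, h⟩ := h
  refine ⟨M * N, mul_ne_zero hM hN, s, hs, ?_⟩
  filter_upwards [h] with t ht
  rw [pow_mul, ht]

lemma HasPuiseuxRoots.mul {p q r : ℂ → ℂ[X]} (hq : HasPuiseuxRoots q) (hr : HasPuiseuxRoots r)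
    (h : ∀ᶠ t in 𝓝 0, p t = q t * r t) : HasPuiseuxRoots p := by
  obtain ⟨M, hM, s, hs, h1⟩ := hq
  obtain ⟨N, hN, u, hu, h2⟩ := hr
  refine ⟨M * N, mul_ne_zero hM hN,
    s.map (fun γ t => γ (t ^ N)) ++ u.map (fun γ t => γ (t ^ M)), ?_, ?_⟩
  · intro γ hγ
    simp only [List.mem_append, List.mem_map] at hγ
    rcases hγ with ⟨γ, h, rfl⟩ | ⟨γ, h, rfl⟩
    · exact (hs _ h).comp_pow hN
    · exact (hu _ h).comp_pow hM
  · filter_upwards [(tendsto_pow_nhds_zero (mul_ne_zero hM hN)).eventually h,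
      (tendsto_pow_nhds_zero hN).eventually h1, (tendsto_pow_nhds_zero hM).eventually h2]
      with t h h1 h2
    rw [← pow_mul, mul_comm N M] at h1
    rw [← pow_mul] at h2
    rw [h, h1, h2]
    simp [Function.comp_def]

lemma HasPuiseuxRoots.of_taylor {p : ℂ → ℂ[X]} {α : ℂ → ℂ} (hα : AnalyticAt ℂ α 0)
    (h : HasPuiseuxRoots fun t => taylor (α t) (p t)) : HasPuiseuxRoots p := by
  obtain ⟨N, hN, s, hs, h⟩ := h
  refine ⟨N, hN, s.map (fun γ t => γ t + α (t ^ N)), ?_, ?_⟩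
  · intro γ hγ
    obtain ⟨γ, h, rfl⟩ := List.mem_map.1 hγ
    exact (hs _ h).add (hα.comp_pow hN)
  · filter_upwards [h] with t ht
    have h1 : p (t ^ N) = taylorAlgHom (-α (t ^ N)) (taylor (α (t ^ N)) (p (t ^ N))) := by
      simp [taylor_taylor]
    rw [h1, ht, map_list_prod, List.map_map, List.map_map]
    congr 1
    refine List.map_congr_left fun γ _ => ?_
    simp [taylor_X, taylor_C]
    ring

lemma HasPuiseuxRoots.of_scaleRoots {p q : ℂ → ℂ[X]} {k : ℕ}
    (h : ∀ᶠ t in 𝓝 0, p t = scaleRoots (q t) (t ^ k)) (hq : HasPuiseuxRoots q) :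
    HasPuiseuxRoots p := by
  obtain ⟨N, hN, s, hs, hqs⟩ := hq
  refine ⟨N, hN, s.map (fun γ t => (t ^ N) ^ k * γ t), ?_, ?_⟩
  · intro γ hγ
    obtain ⟨γ, h, rfl⟩ := List.mem_map.1 hγ
    exact ((analyticAt_id.pow N).pow k).mul (hs _ h)
  · filter_upwards [(tendsto_pow_nhds_zero hN).eventually h, hqs] with t ht hq
    rw [ht, hq, List.map_map]
    clear ht hq hs hqs
    induction s with
    | nil => simp [one_scaleRoots]
    | cons γ s ih =>
      simp only [List.map_cons, List.prod_cons, mul_scaleRoots_of_noZeroDivisors, ih,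
        X_sub_C_scaleRoots, Function.comp_apply, mul_comm (γ t)]

lemma Polynomial.Monic.exists_isCoprime_factorization {q : ℂ[X]} (hq : q.Monic)
    {n : ℕ} (hn : q.natDegree = n + 1) (hc : q.coeff n = 0) (hX : q ≠ X ^ (n + 1)) :
    ∃ g h : ℂ[X], g.Monic ∧ h.Monic ∧ g.natDegree < n + 1 ∧ h.natDegree < n + 1 ∧
      g.natDegree + h.natDegree = n + 1 ∧ IsCoprime g h ∧ q = g * h := by
  obtain ⟨α, hα⟩ := IsAlgClosed.exists_root q (by
    rw [degree_eq_natDegree hq.ne_zero, hn]; exact_mod_cast Nat.succ_ne_zero n)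
  obtain ⟨h, hqh, hnd⟩ := exists_eq_pow_rootMultiplicity_mul_and_not_dvd q hq.ne_zero α
  have hpos := (rootMultiplicity_pos hq.ne_zero).2 hα
  set a := rootMultiplicity α q
  have hg : ((X - C α) ^ a).Monic := (monic_X_sub_C α).pow a
  have hh : h.Monic := hg.of_mul_monic_left (hqh ▸ hq)
  have hga : ((X - C α) ^ a).natDegree = a := by simp
  have hsum : a + h.natDegree = n + 1 := by
    rw [← hn, hqh, hg.natDegree_mul hh, hga]
  refine ⟨_, h, hg, hh, ?_, by omega, by omega, ?_, hqh⟩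
  · rw [hga]
    by_contra! hlt
    have hh1 : h = 1 := hh.natDegree_eq_zero.1 (by omega)
    have ha : a = n + 1 := by omega
    rw [hh1, mul_one, ha] at hqh
    have h2 : q.nextCoeff = (n + 1) * (-α) := by
      rw [hqh, (monic_X_sub_C α).nextCoeff_pow, nextCoeff_X_sub_C]
      simp
    rw [nextCoeff_of_natDegree_pos (by omega), hn, Nat.add_sub_cancel, hc] at h2
    have : α = 0 := by
      have h3 : (n + 1 : ℂ) ≠ 0 := by exact_mod_cast Nat.succ_ne_zero n
      simpa [h3] using h2.symm
    exact hX (by rw [hqh, this]; simp)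
  · exact ((irreducible_X_sub_C α).coprime_iff_not_dvd.2 hnd).pow_left

lemma IsMonicAnalyticFamily.taylor {n : ℕ} {p : ℂ → ℂ[X]} (hp : IsMonicAnalyticFamily n p)
    {α : ℂ → ℂ} (hα : AnalyticAt ℂ α 0) :
    IsMonicAnalyticFamily n (fun t => taylor (α t) (p t)) where
  monic t := by
    have := (hp.monic t).comp_X_add_C (α t)
    rwa [taylor_apply]
  natDegree_eq t := by rw [natDegree_taylor, hp.natDegree_eq]
  analyticAt_coeff := analyticAt_taylor_coeff (fun t => (hp.natDegree_eq t).le)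
    hp.analyticAt_coeff hα

lemma IsMonicAnalyticFamily.exists_taylor_coeff_eq_zero {n : ℕ} {p : ℂ → ℂ[X]}
    (hp : IsMonicAnalyticFamily (n + 1) p) :
    ∃ α : ℂ → ℂ, AnalyticAt ℂ α 0 ∧ ∀ t, (Polynomial.taylor (α t) (p t)).coeff n = 0 := by
  have h3 : (n + 1 : ℂ) ≠ 0 := by exact_mod_cast Nat.succ_ne_zero n
  refine ⟨fun t => -(p t).coeff n / (n + 1), ((hp.analyticAt_coeff n).neg).div_const, fun t => ?_⟩
  have h := hp.natDegree_eq t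
  rw [taylor_coeff, eval_eq_sum_range' (n := 2)]
  · have h1 : (p t).coeff (n + 1) = 1 := by
      conv_lhs => rw [← h]
      exact hp.monic t
    simp only [hasseDeriv_coeff, Finset.sum_range_succ, Finset.sum_range_zero, zero_add,
      Nat.choose_self, add_comm 1 n, h1, Nat.choose_succ_self_right]
    field_simp
    push_cast
    ring
  · have := natDegree_hasseDeriv_le (p t) n
    omega

/-- The Newton polygon step: a family with vanishing subleading coefficient is, after
ramification, either a pure power or a rescaling of a family that is not a pure power
at the origin. -/
lemma IsMonicAnalyticFamily.exists_scaleRoots {n : ℕ} {p : ℂ → ℂ[X]}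
    (hp : IsMonicAnalyticFamily (n + 1) p) (hc : ∀ t, (p t).coeff n = 0) :
    (∀ᶠ t in 𝓝 0, p t = X ^ (n + 1)) ∨
      ∃ (N k : ℕ) (q : ℂ → ℂ[X]), N ≠ 0 ∧ IsMonicAnalyticFamily (n + 1) q ∧
        (∀ᶠ t in 𝓝 0, p (t ^ N) = scaleRoots (q t) (t ^ k)) ∧
        (q 0).coeff n = 0 ∧ q 0 ≠ X ^ (n + 1) := by
  classical
  let Z : ℕ → Prop := fun i => ∀ᶠ t in 𝓝 0, (p t).coeff i = 0
  have hexp : ∀ i, ∃ (m : ℕ) (g : ℂ → ℂ), ¬ Z i → AnalyticAt ℂ g 0 ∧ g 0 ≠ 0 ∧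
      ∀ᶠ t in 𝓝 0, (p t).coeff i = t ^ m * g t := by
    intro i
    rcases (hp.analyticAt_coeff i).eventually_zero_or_exists_pow_mul with h | ⟨m, g, hg, hg0, h⟩
    · exact ⟨0, 0, fun hZ => absurd (h.mono fun t ht => ht.1) hZ⟩
    · exact ⟨m, g, fun _ => ⟨hg, hg0, h.mono fun t ht => ht.1⟩⟩
  choose m g hmg using hexp
  let S := (Finset.range (n + 1)).filter fun i => ¬ Z i
  rcases S.eq_empty_or_nonempty with hS | hS
  · left
    have hZ : ∀ᶠ t in 𝓝 0, ∀ i : Fin (n + 1), (p t).coeff i = 0 := by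
      refine eventually_all.2 fun i => ?_
      by_contra hi
      have : (i : ℕ) ∈ S := Finset.mem_filter.2 ⟨Finset.mem_range.2 i.2, hi⟩
      simp [hS] at this
    filter_upwards [hZ] with t ht
    rw [(hp.monic t).eq_X_pow_add_ofFn (hp.natDegree_eq t)]
    have : (fun i : Fin (n + 1) => (p t).coeff i) = 0 := funext ht
    rw [this, map_zero, add_zero]
  · right
    obtain ⟨i₀, hi₀, hmin⟩ := S.exists_min_image (fun i => (m i : ℚ) / ((n + 1 - i : ℕ) : ℚ)) hS
    obtain ⟨hi₀n, hi₀Z⟩ := Finset.mem_filter.1 hi₀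
    have hi₀n := Finset.mem_range.1 hi₀n
    set N := n + 1 - i₀ with hN
    set k := m i₀ with hk
    have hN0 : N ≠ 0 := by omega
    have hle : ∀ i < n + 1, ¬ Z i → k * (n + 1 - i) ≤ N * m i := by
      intro i hi hZ
      have := hmin i (Finset.mem_filter.2 ⟨Finset.mem_range.2 hi, hZ⟩)
      have h1 : 0 < ((n + 1 - i : ℕ) : ℚ) := by exact_mod_cast (by omega : 0 < n + 1 - i)
      have h2 : 0 < (N : ℚ) := by exact_mod_cast Nat.pos_of_ne_zero hN0
      rw [div_le_div_iff₀ h2 h1] at this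
      rw [mul_comm N]
      exact_mod_cast this
    let b : ℂ → Fin (n + 1) → ℂ := fun t i =>
      if Z i then 0 else t ^ (N * m i - k * (n + 1 - i)) * g i (t ^ N)
    have hb : AnalyticAt ℂ b 0 := by
      refine analyticAt_pi_iff.2 fun i => ?_
      by_cases hZ : Z i
      · simp only [hZ, if_true]
        exact analyticAt_const
      · simp only [hZ, if_false]
        exact (analyticAt_id.pow _).mul ((hmg i hZ).1.comp_pow hN0)
    have hq := isMonicAnalyticFamily_X_pow_add_ofFn hb
    refine ⟨N, k, _, hN0, hq, ?_, ?_, ?_⟩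
    · have hall : ∀ᶠ t in 𝓝 0, ∀ i : Fin (n + 1), (p (t ^ N)).coeff i =
          b t i * (t ^ k) ^ (n + 1 - i) := by
        refine eventually_all.2 fun i => ?_
        by_cases hZ : Z i
        · filter_upwards [(tendsto_pow_nhds_zero hN0).eventually hZ] with t ht
          simp [b, hZ, ht]
        · filter_upwards [(tendsto_pow_nhds_zero hN0).eventually (hmg i hZ).2.2] with t ht
          simp only [b, hZ, if_false, ht]
          rw [← pow_mul, ← pow_mul, mul_right_comm, ← pow_add,
            Nat.sub_add_cancel (hle i i.2 hZ)]
      filter_upwards [hall] with t ht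
      ext i
      rw [coeff_scaleRoots, hq.natDegree_eq t]
      rcases lt_trichotomy i (n + 1) with hi | hi | hi
      · rw [coeff_X_pow_add_ofFn, dif_pos hi]
        exact ht ⟨i, hi⟩
      · have h1 : (p (t ^ N)).coeff (n + 1) = 1 := by
          conv_lhs => rw [← hp.natDegree_eq (t ^ N)]
          exact hp.monic _
        subst hi
        simp [h1]
      · rw [coeff_eq_zero_of_natDegree_lt (by rw [hp.natDegree_eq]; exact hi),
          coeff_eq_zero_of_natDegree_lt (by rw [hq.natDegree_eq t]; exact hi), zero_mul]
    · have hZ : Z n := Eventually.of_forall hc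
      rw [coeff_X_pow_add_ofFn, dif_pos (Nat.lt_succ_self n)]
      simp [b, hZ]
    · intro h
      have h1 := congrArg (fun r : ℂ[X] => r.coeff i₀) h
      simp only [coeff_X_pow_add_ofFn, dif_pos hi₀n, coeff_X_pow, hi₀n.ne, if_false] at h1
      have hg0 := (hmg i₀ hi₀Z).2.1
      simp only [b, hi₀Z, if_false, ← hN, ← hk, mul_comm k N, Nat.sub_self, pow_zero, one_mul,
        zero_pow hN0] at h1
      exact hg0 h1

/-- The **Puiseux theorem**: a monic polynomial with coefficients analytic at the origin splits
into linear factors with analytic roots after a ramified change of parameter. -/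
theorem IsMonicAnalyticFamily.hasPuiseuxRoots {n : ℕ} {p : ℂ → ℂ[X]}
    (hp : IsMonicAnalyticFamily n p) : HasPuiseuxRoots p := by
  induction n using Nat.strong_induction_on generalizing p with
  | _ n ih =>
    rcases n with _ | n
    · refine ⟨1, one_ne_zero, [], by simp, Eventually.of_forall fun t => ?_⟩
      simpa using (hp.monic _).natDegree_eq_zero.1 (hp.natDegree_eq _)
    · obtain ⟨α, hα, hc⟩ := hp.exists_taylor_coeff_eq_zero
      refine HasPuiseuxRoots.of_taylor hα ?_
      rcases (hp.taylor hα).exists_scaleRoots hc with h | ⟨N, k, q, hN, hq, hpq, hq0, hqX⟩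
      · refine ⟨1, one_ne_zero, List.replicate (n + 1) 0, ?_, ?_⟩
        · intro γ hγ
          rw [List.eq_of_mem_replicate hγ]
          exact analyticAt_const
        · filter_upwards [h] with t ht
          simpa using ht
      · refine HasPuiseuxRoots.of_comp_pow hN (HasPuiseuxRoots.of_scaleRoots hpq ?_)
        obtain ⟨g, h, hg, hh, hgn, hhn, hsum, hcop, hgh⟩ :=
          (hq.monic 0).exists_isCoprime_factorization (hq.natDegree_eq 0) hq0 hqX
        rw [← hsum] at hq
        obtain ⟨r, s, hr, hs, hrs⟩ := hq.exists_factorization hg hh rfl rfl hcop hgh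
        exact (ih _ hgn hr).mul (ih _ hhn hs) hrs

/-- The restriction of a polynomial in two variables to the line where the second variable
equals `y`. -/
noncomputable def fiber (g : MvPolynomial (Fin 2) ℂ) (y : ℂ) : ℂ[X] :=
  MvPolynomial.aeval ![X, C y] g

lemma eval_fiber (g : MvPolynomial (Fin 2) ℂ) (x y : ℂ) :
    (fiber g y).eval x = MvPolynomial.eval ![x, y] g := by
  unfold fiber
  induction g using MvPolynomial.induction_on with
  | C a => simp
  | add p q hp hq => simp [hp, hq]
  | mul_X p i hp => fin_cases i <;> simp [hp]

lemma derivative_fiber (g : MvPolynomial (Fin 2) ℂ) (y : ℂ) :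
    derivative (fiber g y) = fiber (MvPolynomial.pderiv 0 g) y := by
  unfold fiber
  induction g using MvPolynomial.induction_on with
  | C a => simp
  | add p q hp hq => simp [hp, hq]
  | mul_X p i hp => fin_cases i <;> simp [hp, Derivation.leibniz, MvPolynomial.pderiv_X] <;> ring

lemma analyticAt_coeff_fiber (g : MvPolynomial (Fin 2) ℂ) (k : ℕ) (y₀ : ℂ) :
    AnalyticAt ℂ (fun y => (fiber g y).coeff k) y₀ := by
  unfold fiber
  induction g using MvPolynomial.induction_on generalizing k with
  | C a =>
    simp only [MvPolynomial.algHom_C]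
    exact analyticAt_const
  | add p q hp hq =>
    simp only [map_add, coeff_add]
    exact (hp k).add (hq k)
  | mul_X p i hp =>
    fin_cases i
    · rcases k with _ | k
      · simpa using analyticAt_const
      · simpa using hp k
    · simpa using! (hp k).mul analyticAt_id

/-- The chain rule for a polynomial evaluated along a curve. -/
lemma MvPolynomial.hasDerivAt_eval {𝕜 σ : Type*} [NontriviallyNormedField 𝕜] [Fintype σ]
    (g : MvPolynomial σ 𝕜) {z : 𝕜 → σ → 𝕜} {z' : σ → 𝕜} {t : 𝕜}
    (hz : ∀ i, HasDerivAt (fun t => z t i) (z' i) t) :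
    HasDerivAt (fun t => eval (z t) g) (∑ i, eval (z t) (pderiv i g) * z' i) t := by
  classical
  induction g using MvPolynomial.induction_on with
  | C a => simpa using hasDerivAt_const t a
  | add p q hp hq => simpa [add_mul, Finset.sum_add_distrib] using hp.fun_add hq
  | mul_X p i hp =>
    have h : ∑ j, eval (z t) (pderiv j (p * X i)) * z' j =
        (∑ j, eval (z t) (pderiv j p) * z' j) * z t i + eval (z t) p * z' i := by
      simp only [Derivation.leibniz, smul_eq_mul, map_add, map_mul, eval_X, add_mul,
        Finset.sum_add_distrib, pderiv_X, Finset.sum_mul]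
      rw [add_comm]
      congr 1
      · exact Finset.sum_congr rfl fun j _ => by ring
      · rw [Finset.sum_eq_single i]
        · simp
        · intro j _ hj
          simp [hj.symm]
        · simp
    rw [h]
    simpa using hp.fun_mul (hz i)

/-- The coefficients of a product of linear factors are dominated by those of the product with
nonnegative coefficients. -/
lemma norm_coeff_prod_X_sub_C_mul_pow_le (s : List ℂ) (m : ℕ) {r : ℝ} (hr : 0 ≤ r) :
    ‖((s.map fun δ => X - C δ).prod).coeff m‖ * r ^ m ≤ (s.map fun δ => r + ‖δ‖).prod := by
  have h1 : ∀ m, 0 ≤ ((s.map fun δ => X + C ‖δ‖).prod).coeff m ∧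
      ‖((s.map fun δ => X - C δ).prod).coeff m‖ ≤ ((s.map fun δ => X + C ‖δ‖).prod).coeff m := by
    induction s with
    | nil =>
      intro m
      simp only [List.map_nil, List.prod_nil, coeff_one]
      split_ifs <;> simp
    | cons δ s ih =>
      intro m
      simp only [List.map_cons, List.prod_cons, add_mul, sub_mul, coeff_add, coeff_sub,
        coeff_C_mul]
      rcases m with _ | m
      · simp only [coeff_X_mul_zero, zero_add, zero_sub, norm_neg, norm_mul]
        exact ⟨mul_nonneg (norm_nonneg _) (ih 0).1,
          mul_le_mul_of_nonneg_left (ih 0).2 (norm_nonneg _)⟩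
      · simp only [coeff_X_mul]
        refine ⟨add_nonneg (ih m).1 (mul_nonneg (norm_nonneg _) (ih _).1),
          (norm_sub_le _ _).trans (add_le_add (ih m).2 ?_)⟩
        rw [norm_mul]
        exact mul_le_mul_of_nonneg_left (ih _).2 (norm_nonneg _)
  have h2 : (s.map fun δ => r + ‖δ‖).prod = ((s.map fun δ => X + C ‖δ‖).prod).eval r := by
    rw [eval_list_prod, List.map_map]
    simp [Function.comp_def]
  have h3 : ((s.map fun δ => X + C ‖δ‖).prod).natDegree <
      ((s.map fun δ => X + C ‖δ‖).prod).natDegree + 1 + m := by omega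
  rw [h2, eval_eq_sum_range' h3]
  refine (mul_le_mul_of_nonneg_right (h1 m).2 (pow_nonneg hr m)).trans ?_
  exact Finset.single_le_sum (f := fun i => ((s.map fun δ => X + C ‖δ‖).prod).coeff i * r ^ i)
    (fun i _ => mul_nonneg (h1 i).1 (pow_nonneg hr i))
    (Finset.mem_range.2 (by omega : m < _ + 1 + m))

/-- At a point `x`, the terms of the Taylor expansion of a split polynomial at its root closest
to `x` are controlled by the value at `x`. -/
lemma norm_taylor_coeff_mul_pow_le {s : List ℂ} {x γ : ℂ} (h : ∀ δ ∈ s, ‖x - γ‖ ≤ ‖x - δ‖)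
    (m : ℕ) :
    ‖(taylor γ (s.map fun δ => X - C δ).prod).coeff m‖ * ‖x - γ‖ ^ m ≤
      3 ^ s.length * ‖((s.map fun δ => X - C δ).prod).eval x‖ := by
  have h1 : taylor γ (s.map fun δ => X - C δ).prod =
      ((s.map fun δ => δ - γ).map fun δ => X - C δ).prod := by
    rw [← taylorAlgHom_apply, map_list_prod, List.map_map, List.map_map]
    congr 1
    refine List.map_congr_left fun δ _ => ?_
    simp [taylor_X, taylor_C]
    ring
  rw [h1]
  refine (norm_coeff_prod_X_sub_C_mul_pow_le _ m (norm_nonneg _)).trans ?_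
  clear h1
  induction s with
  | nil => simp
  | cons δ s ih =>
    simp only [List.map_cons, List.prod_cons, eval_mul, norm_mul, List.length_cons]
    have hδ := h δ (by simp)
    have h2 : ‖δ - γ‖ ≤ 2 * ‖x - δ‖ := by
      have : δ - γ = (x - γ) - (x - δ) := by ring
      rw [this]
      linarith [norm_sub_le (x - γ) (x - δ)]
    have h3 : ‖x - γ‖ + ‖δ - γ‖ ≤ 3 * ‖x - δ‖ := by linarith
    calc _ ≤ (3 * ‖x - δ‖) * (3 ^ s.length * ‖((s.map fun δ => X - C δ).prod).eval x‖) := by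
          refine mul_le_mul h3 (ih fun δ hδ => h δ (by simp [hδ])) ?_ (by positivity)
          refine List.prod_nonneg fun a ha => ?_
          simp only [List.map_map, List.mem_map] at ha
          obtain ⟨b, -, rfl⟩ := ha
          simp only [Function.comp_apply]
          positivity
      _ = _ := by simp; ring

lemma analyticAt_taylor_coeff_fiber {g : MvPolynomial (Fin 2) ℂ} {n N : ℕ}
    (hdeg : ∀ y, (fiber g y).natDegree ≤ n) (hN : N ≠ 0) {Γ : ℂ → ℂ} (hΓ : AnalyticAt ℂ Γ 0)
    (k : ℕ) : AnalyticAt ℂ (fun t => (taylor (Γ t) (fiber g (t ^ N))).coeff k) 0 :=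
  analyticAt_taylor_coeff (fun _ => hdeg _)
    (fun k => (analyticAt_coeff_fiber g k 0).comp_pow hN) hΓ k

lemma eval_eq_sum_taylor_coeff_fiber {g : MvPolynomial (Fin 2) ℂ} {n : ℕ}
    (hdeg : ∀ y, (fiber g y).natDegree ≤ n) (γ ξ y : ℂ) :
    MvPolynomial.eval ![γ + ξ, y] g =
      ∑ k ∈ Finset.range (n + 1), (taylor γ (fiber g y)).coeff k * ξ ^ k := by
  rw [← eval_fiber, add_comm, ← taylor_eval, eval_eq_sum_range' (n := n + 1)]
  rw [natDegree_taylor]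
  have := hdeg y
  omega

/-- The Euler derivative of the Taylor expansion along the curve `t ↦ (Γ t, t ^ N)`. -/
lemma eventually_sum_mul_deriv_taylor_coeff_fiber {g : MvPolynomial (Fin 2) ℂ} {n N : ℕ}
    (hdeg : ∀ y, (fiber g y).natDegree ≤ n) (hN : N ≠ 0) {Γ : ℂ → ℂ} (hΓ : AnalyticAt ℂ Γ 0) :
    ∀ᶠ t in 𝓝 0, ∀ ξ : ℂ,
      ∑ k ∈ Finset.range (n + 1),
        t * deriv (fun t => (taylor (Γ t) (fiber g (t ^ N))).coeff k) t * ξ ^ k =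
      MvPolynomial.eval ![Γ t + ξ, t ^ N] (MvPolynomial.pderiv 0 g) * (t * deriv Γ t) +
        N * (t ^ N * MvPolynomial.eval ![Γ t + ξ, t ^ N] (MvPolynomial.pderiv 1 g)) := by
  have han := fun k => (analyticAt_taylor_coeff_fiber hdeg hN hΓ k).eventually_analyticAt
  have hall : ∀ᶠ t in 𝓝 0, ∀ k ∈ Finset.range (n + 1), AnalyticAt ℂ
      (fun t => (taylor (Γ t) (fiber g (t ^ N))).coeff k) t :=
    (Finset.eventually_all _).2 fun k _ => han k
  filter_upwards [hall, hΓ.eventually_analyticAt] with t ht hΓt ξ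
  have h1 : HasDerivAt (fun t => MvPolynomial.eval ![Γ t + ξ, t ^ N] g)
      (∑ k ∈ Finset.range (n + 1),
        deriv (fun t => (taylor (Γ t) (fiber g (t ^ N))).coeff k) t * ξ ^ k) t := by
    simp only [eval_eq_sum_taylor_coeff_fiber hdeg]
    exact HasDerivAt.fun_sum fun k hk => (ht k hk).differentiableAt.hasDerivAt.mul_const _
  have h2 := MvPolynomial.hasDerivAt_eval g (z := fun t => ![Γ t + ξ, t ^ N])
    (z' := ![deriv Γ t, N * t ^ (N - 1)]) (t := t) (by
      intro i
      fin_cases i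
      · exact hΓt.differentiableAt.hasDerivAt.add_const ξ
      · exact hasDerivAt_pow N t)
  have h3 := h1.unique h2
  simp only [mul_assoc]
  rw [← Finset.mul_sum, h3]
  obtain ⟨M, rfl⟩ := Nat.exists_eq_succ_of_ne_zero hN
  simp [Fin.sum_univ_two]
  ring

/-- Bounds near a polar branch `t ↦ (Γ t, t ^ N)`, at points whose displacement `ξ` from the
branch is such that the higher terms of the Taylor expansion are controlled by the derivative. -/
lemma exists_polar_branch_bound {g : MvPolynomial (Fin 2) ℂ} {n N : ℕ}
    (hdeg : ∀ y, (fiber g y).natDegree ≤ n + 1) (hN : N ≠ 0) {Γ : ℂ → ℂ} (hΓ : AnalyticAt ℂ Γ 0)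
    (hΓ0 : Γ 0 = 0) (h0 : MvPolynomial.eval ![0, 0] g = 0)
    (hroot : ∀ᶠ t in 𝓝 0, MvPolynomial.eval ![Γ t, t ^ N] (MvPolynomial.pderiv 0 g) = 0)
    {M : ℝ} (hM : 0 ≤ M) :
    ∃ A : ℝ, 0 ≤ A ∧ ∀ᶠ t in 𝓝 0, ∀ ξ : ℂ,
      (∀ k, ‖(taylor (Γ t) (fiber g (t ^ N))).coeff (k + 1)‖ * ‖ξ‖ ^ k ≤
        M * ‖MvPolynomial.eval ![Γ t + ξ, t ^ N] (MvPolynomial.pderiv 0 g)‖) →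
      ‖MvPolynomial.eval ![Γ t + ξ, t ^ N] g‖ ≤
        A * (‖t ^ N‖ * ‖MvPolynomial.eval ![Γ t, t ^ N] (MvPolynomial.pderiv 1 g)‖ +
          ‖ξ‖ * ‖MvPolynomial.eval ![Γ t + ξ, t ^ N] (MvPolynomial.pderiv 0 g)‖) ∧
      ‖t ^ N‖ * ‖MvPolynomial.eval ![Γ t + ξ, t ^ N] (MvPolynomial.pderiv 1 g) -
          MvPolynomial.eval ![Γ t, t ^ N] (MvPolynomial.pderiv 1 g)‖ ≤
        A * ((‖Γ t‖ + ‖ξ‖) *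
          ‖MvPolynomial.eval ![Γ t + ξ, t ^ N] (MvPolynomial.pderiv 0 g)‖) := by
  set c : ℕ → ℂ → ℂ := fun k t => (taylor (Γ t) (fiber g (t ^ N))).coeff k with hc
  have han : ∀ k, AnalyticAt ℂ (c k) 0 := analyticAt_taylor_coeff_fiber hdeg hN hΓ
  have hc0 : c 0 0 = 0 := by
    simp only [hc, taylor_coeff_zero, eval_fiber, hΓ0, zero_pow hN, h0]
  obtain ⟨C₀, hC₀, hb₀⟩ := ((han 0).isBigO_id_mul_deriv hc0).exists_nonneg
  obtain ⟨CΓ, hCΓ, hbΓ⟩ := hΓ.id_mul_deriv_isBigO.exists_nonneg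
  choose Ck hCk hbk using fun k => (han k).id_mul_deriv_isBigO.exists_nonneg
  set S := ∑ k ∈ Finset.range (n + 1), Ck (k + 1) with hS
  have hS0 : 0 ≤ S := Finset.sum_nonneg fun k _ => hCk _
  refine ⟨C₀ * N + (n + 1) * M + S * M + CΓ, by positivity, ?_⟩
  have hbk' : ∀ᶠ t in 𝓝 0, ∀ k ∈ Finset.range (n + 1),
      ‖t * deriv (c (k + 1)) t‖ ≤ Ck (k + 1) * ‖c (k + 1) t‖ :=
    (Finset.eventually_all _).2 fun k _ => (hbk (k + 1)).bound
  filter_upwards [hroot, hb₀.bound, hbΓ.bound, hbk',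
    eventually_sum_mul_deriv_taylor_coeff_fiber hdeg hN hΓ] with t hroot hb₀ hbΓ hbk heul ξ hξ
  change ∀ ξ, ∑ k ∈ Finset.range (n + 1 + 1), t * deriv (c k) t * ξ ^ k = _ at heul
  change ∀ k, ‖c (k + 1) t‖ * ‖ξ‖ ^ k ≤ _ at hξ
  have hexp := eval_eq_sum_taylor_coeff_fiber hdeg (Γ t) ξ (t ^ N)
  change _ = ∑ k ∈ Finset.range (n + 1 + 1), c k t * ξ ^ k at hexp
  have heul0 := heul 0
  have heulξ := heul ξ
  rw [Finset.sum_range_succ'] at heul0 heulξ hexp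
  simp only [add_zero, hroot, zero_mul, zero_add, pow_zero, mul_one, ne_eq, Nat.add_eq_zero_iff,
    one_ne_zero, and_false, not_false_eq_true, zero_pow, mul_zero, Finset.sum_const_zero]
    at heul0 heulξ hexp
  rw [heul0] at heulξ hb₀
  set Fx := MvPolynomial.eval ![Γ t + ξ, t ^ N] (MvPolynomial.pderiv 0 g)
  set Fy := MvPolynomial.eval ![Γ t + ξ, t ^ N] (MvPolynomial.pderiv 1 g)
  set Fy₀ := MvPolynomial.eval ![Γ t, t ^ N] (MvPolynomial.pderiv 1 g)
  have hN1 : (1 : ℝ) ≤ N := by exact_mod_cast Nat.one_le_iff_ne_zero.2 hN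
  constructor
  · have h1 : ‖∑ k ∈ Finset.range (n + 1), c (k + 1) t * ξ ^ (k + 1)‖ ≤
        (n + 1) * M * (‖ξ‖ * ‖Fx‖) := by
      refine (norm_sum_le _ _).trans
        ((Finset.sum_le_card_nsmul _ _ (M * ‖Fx‖ * ‖ξ‖) ?_).trans_eq ?_)
      · intro k _
        rw [norm_mul, norm_pow, pow_succ, ← mul_assoc]
        exact mul_le_mul_of_nonneg_right (hξ k) (norm_nonneg _)
      · simp
        ring
    have h2 : ‖c 0 t‖ ≤ C₀ * N * (‖t ^ N‖ * ‖Fy₀‖) := by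
      refine hb₀.trans_eq ?_
      simp only [norm_mul, Complex.norm_natCast]
      ring
    rw [hexp]
    refine (norm_add_le _ _).trans ((add_le_add h1 h2).trans ?_)
    have e1 : 0 ≤ ‖t ^ N‖ * ‖Fy₀‖ := by positivity
    have e2 : 0 ≤ ‖ξ‖ * ‖Fx‖ := by positivity
    have a1 : 0 ≤ C₀ * N := by positivity
    have a2 : 0 ≤ (n + 1) * M := by positivity
    have a3 : 0 ≤ S * M := by positivity
    nlinarith [mul_nonneg a1 e2, mul_nonneg a2 e1, mul_nonneg a3 e1, mul_nonneg a3 e2,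
      mul_nonneg hCΓ e1, mul_nonneg hCΓ e2]
  · have h1 : ‖∑ k ∈ Finset.range (n + 1), t * deriv (c (k + 1)) t * ξ ^ (k + 1)‖ ≤
        S * M * (‖ξ‖ * ‖Fx‖) := by
      rw [hS, Finset.sum_mul, Finset.sum_mul]
      refine (norm_sum_le _ _).trans (Finset.sum_le_sum fun k hk => ?_)
      calc _ = ‖t * deriv (c (k + 1)) t‖ * ‖ξ‖ ^ (k + 1) := by rw [norm_mul, norm_pow]
        _ ≤ Ck (k + 1) * ‖c (k + 1) t‖ * ‖ξ‖ ^ (k + 1) :=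
          mul_le_mul_of_nonneg_right (hbk k hk) (by positivity)
        _ = Ck (k + 1) * (‖c (k + 1) t‖ * ‖ξ‖ ^ k) * ‖ξ‖ := by ring
        _ ≤ Ck (k + 1) * (M * ‖Fx‖) * ‖ξ‖ := by
          have := hCk (k + 1)
          have := hξ k
          gcongr
        _ = _ := by ring
    have h2 : N * (t ^ N * (Fy - Fy₀)) =
        (∑ k ∈ Finset.range (n + 1), t * deriv (c (k + 1)) t * ξ ^ (k + 1)) -
          Fx * (t * deriv Γ t) := by
      linear_combination -heulξ
    have h3 : ‖t ^ N‖ * ‖Fy - Fy₀‖ ≤ ‖N * (t ^ N * (Fy - Fy₀))‖ := by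
      rw [norm_mul, norm_mul, Complex.norm_natCast]
      exact le_mul_of_one_le_left (by positivity) hN1
    refine h3.trans ?_
    rw [h2]
    refine (norm_sub_le _ _).trans ((add_le_add h1 (?_ : _ ≤ CΓ * (‖Γ t‖ * ‖Fx‖))).trans ?_)
    · rw [norm_mul]
      calc ‖Fx‖ * ‖t * deriv Γ t‖ ≤ ‖Fx‖ * (CΓ * ‖Γ t‖) := by gcongr
        _ = _ := by ring
    · have e1 : 0 ≤ ‖Γ t‖ * ‖Fx‖ := by positivity
      have e2 : 0 ≤ ‖ξ‖ * ‖Fx‖ := by positivity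
      have a1 : 0 ≤ C₀ * N := by positivity
      have a2 : 0 ≤ (n + 1) * M := by positivity
      have a3 : 0 ≤ S * M := by positivity
      nlinarith [mul_nonneg a1 e2, mul_nonneg a2 e1, mul_nonneg a3 e1, mul_nonneg a1 e1,
        mul_nonneg hCΓ e2, mul_nonneg a2 e2]

lemma exists_pow_le_mul_pow_succ_of_polar_bound {n D : ℕ} (hnD : n ≤ D) {A K M c : ℝ}
    (hA : 0 ≤ A) (hK : 0 ≤ K) (hM : 0 ≤ M) (hc : 0 < c) :
    ∃ C : ℝ, 0 ≤ C ∧ ∀ F Fx Fy Fy₀ y ξ γ : ℝ, 0 ≤ F → 0 ≤ Fx → 0 ≤ Fy → 0 ≤ Fy₀ → 0 ≤ y → 0 ≤ ξ →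
      ξ ≤ 1 → ξ ^ n ≤ M * Fx → γ ≤ K * y → (Fy₀ = 0 ∨ c * y ^ D ≤ Fy₀) →
      F ≤ A * (y * Fy₀ + ξ * Fx) → y * Fy₀ ≤ y * Fy + A * ((γ + ξ) * Fx) →
      F ^ D ≤ C * (Fx + Fy) ^ (D + 1) := by
  set B₁ := 1 + A * (K + 1) with hB₁
  have hB₁0 : 0 < B₁ := by positivity
  set B := A * (B₁ + 1) with hB
  have hB0 : 0 ≤ B := by positivity
  refine ⟨B ^ D * (M + B₁ / c), by positivity, ?_⟩
  intro F Fx Fy Fy₀ y ξ γ hF hFx hFy hFy₀ hy hξ hξ1 hξn hγ hdich h1 h2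
  have hT : 0 ≤ Fx + Fy := by positivity
  suffices ∃ ρ : ℝ, 0 ≤ ρ ∧ F ≤ B * (ρ * (Fx + Fy)) ∧ ρ ^ D ≤ (M + B₁ / c) * (Fx + Fy) by
    obtain ⟨ρ, hρ, hFρ, hρD⟩ := this
    calc F ^ D ≤ (B * (ρ * (Fx + Fy))) ^ D := pow_le_pow_left₀ hF hFρ D
      _ = B ^ D * ρ ^ D * (Fx + Fy) ^ D := by rw [mul_pow B, mul_pow ρ, mul_assoc (B ^ D)]
      _ ≤ B ^ D * ((M + B₁ / c) * (Fx + Fy)) * (Fx + Fy) ^ D := by gcongr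
      _ = _ := by ring
  have hξD : ξ ^ D ≤ (M + B₁ / c) * (Fx + Fy) :=
    calc ξ ^ D ≤ ξ ^ n := pow_le_pow_of_le_one hξ hξ1 hnD
      _ ≤ M * Fx := hξn
      _ ≤ (M + B₁ / c) * (Fx + Fy) := by gcongr <;> linarith [div_nonneg hB₁0.le hc.le]
  have hmax : ∀ r, 0 ≤ r → y ≤ r → ξ ≤ r → y * Fy₀ ≤ B₁ * (r * (Fx + Fy)) := by
    intro r hr hyr hξr
    calc y * Fy₀ ≤ y * Fy + A * ((γ + ξ) * Fx) := h2
      _ ≤ r * (Fx + Fy) + A * ((K * r + r) * (Fx + Fy)) := by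
          have : γ ≤ K * r := hγ.trans (by gcongr)
          gcongr <;> linarith
      _ = _ := by rw [hB₁]; ring
  rcases le_or_gt y ξ with hyξ | hyξ
  · refine ⟨ξ, hξ, ?_, hξD⟩
    calc F ≤ A * (y * Fy₀ + ξ * Fx) := h1
      _ ≤ A * (B₁ * (ξ * (Fx + Fy)) + ξ * (Fx + Fy)) := by
        have := hmax ξ hξ hyξ le_rfl
        gcongr
        linarith
      _ = _ := by rw [hB]; ring
  · rcases hdich with h0 | hcy
    · refine ⟨ξ, hξ, ?_, hξD⟩
      rw [h0, mul_zero, zero_add] at h1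
      calc F ≤ A * (ξ * Fx) := h1
        _ ≤ A * (B₁ + 1) * (ξ * (Fx + Fy)) := by
          gcongr
          · exact le_mul_of_one_le_right hA (by linarith)
          · linarith
    · have hy0 : 0 < y := hξ.trans_lt hyξ
      have h3 := hmax y hy le_rfl hyξ.le
      have h4 : Fy₀ ≤ B₁ * (Fx + Fy) := by
        refine le_of_mul_le_mul_left ?_ hy0
        linarith
      refine ⟨y, hy, ?_, ?_⟩
      · calc F ≤ A * (y * Fy₀ + ξ * Fx) := h1
          _ ≤ A * (B₁ * (y * (Fx + Fy)) + y * (Fx + Fy)) := by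
            gcongr
            linarith
          _ = _ := by rw [hB]; ring
      · have h5 : y ^ D ≤ B₁ / c * (Fx + Fy) := by
          rw [div_mul_eq_mul_div, le_div_iff₀ hc]
          linarith
        have : 0 ≤ M * (Fx + Fy) := by positivity
        linarith

/-- Near a point of the fiber whose closest polar branch is the given one, the Taylor
coefficients on that branch are controlled by the derivative. -/
lemma norm_taylor_coeff_fiber_mul_pow_le {p : ℂ[X]} {b : ℂ} {s : List ℂ}
    (hp : derivative p = C b * (s.map fun δ => X - C δ).prod) {x γ : ℂ}
    (h : ∀ δ ∈ s, ‖x - γ‖ ≤ ‖x - δ‖) (k : ℕ) :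
    ‖(taylor γ p).coeff (k + 1)‖ * ‖x - γ‖ ^ k ≤ 3 ^ s.length * ‖(derivative p).eval x‖ := by
  have h1 : (taylor γ p).coeff (k + 1) * (k + 1) = (taylor γ (derivative p)).coeff k := by
    rw [← coeff_derivative, taylor_apply, taylor_apply, derivative_comp]
    simp
  rw [hp, taylor_mul, taylor_C, coeff_C_mul] at h1
  have h2 : ‖(taylor γ p).coeff (k + 1)‖ ≤
      ‖b‖ * ‖(taylor γ (s.map fun δ => X - C δ).prod).coeff k‖ := by
    rw [← norm_mul, ← h1, norm_mul]
    refine le_mul_of_one_le_right (norm_nonneg _) ?_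
    have : ((k : ℂ) + 1) = ((k + 1 : ℕ) : ℂ) := by push_cast; ring
    rw [this, Complex.norm_natCast]
    exact_mod_cast Nat.le_add_left 1 k
  calc _ ≤ ‖b‖ * ‖(taylor γ (s.map fun δ => X - C δ).prod).coeff k‖ * ‖x - γ‖ ^ k := by gcongr
    _ = ‖b‖ * (‖(taylor γ (s.map fun δ => X - C δ).prod).coeff k‖ * ‖x - γ‖ ^ k) := by ring
    _ ≤ ‖b‖ * (3 ^ s.length * ‖((s.map fun δ => X - C δ).prod).eval x‖) := by
      exact mul_le_mul_of_nonneg_left (norm_taylor_coeff_mul_pow_le h k) (norm_nonneg _)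
    _ = _ := by rw [hp, eval_mul, eval_C, norm_mul]; ring

/-- The derivative of a family of polynomials with constant leading coefficient splits into
polar branches. -/
lemma exists_polar_branches {g : MvPolynomial (Fin 2) ℂ} {n : ℕ} {a : ℂ} (ha : a ≠ 0)
    (hdeg : ∀ y, (fiber g y).natDegree ≤ n + 1) (hlead : ∀ y, (fiber g y).coeff (n + 1) = a) :
    ∃ N : ℕ, N ≠ 0 ∧ ∃ s : List (ℂ → ℂ), (∀ γ ∈ s, AnalyticAt ℂ γ 0) ∧ ∃ b : ℂ, b ≠ 0 ∧
      ∀ᶠ t in 𝓝 0, derivative (fiber g (t ^ N)) = C b * (s.map fun γ => X - C (γ t)).prod := by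
  have hb : a * (n + 1) ≠ 0 := mul_ne_zero ha (by exact_mod_cast Nat.succ_ne_zero n)
  have hcoeff : ∀ y, (derivative (fiber g y)).coeff n = a * (n + 1) := by
    intro y
    rw [coeff_derivative, hlead]
  have hnd : ∀ y, (derivative (fiber g y)).natDegree = n := by
    intro y
    refine le_antisymm ?_ (le_natDegree_of_ne_zero (by rw [hcoeff]; exact hb))
    exact (natDegree_derivative_le _).trans (Nat.sub_le_of_le_add (hdeg y))
  have hfam : IsMonicAnalyticFamily n
      (fun y => C (a * (n + 1))⁻¹ * derivative (fiber g y)) := by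
    refine ⟨fun y => ?_, fun y => ?_, fun k => ?_⟩
    · refine monic_C_mul_of_mul_leadingCoeff_eq_one ?_
      rw [leadingCoeff, hnd, hcoeff, inv_mul_cancel₀ hb]
    · rw [natDegree_C_mul (inv_ne_zero hb), hnd]
    · simp only [coeff_C_mul, coeff_derivative]
      exact analyticAt_const.mul ((analyticAt_coeff_fiber g (k + 1) 0).mul analyticAt_const)
  obtain ⟨N, hN, s, hs, h⟩ := hfam.hasPuiseuxRoots
  refine ⟨N, hN, s, hs, _, hb, ?_⟩
  filter_upwards [h] with t ht
  rw [← ht, ← mul_assoc, ← C_mul, mul_inv_cancel₀ hb, C_1, one_mul]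

/-- The gradient inequality, in coordinates where the polar curve is transverse to the
`x`-axis, when `∂g/∂y` is bounded below by a power of `y` on the components of the polar curve
where it does not vanish. -/
theorem exists_norm_pow_le_mul_pow_succ {g : MvPolynomial (Fin 2) ℂ} {n D : ℕ} (hnD : n ≤ D)
    {a : ℂ} (ha : a ≠ 0) (hdeg : ∀ y, (fiber g y).natDegree ≤ n + 1)
    (hlead : ∀ y, (fiber g y).coeff (n + 1) = a)
    (h0 : MvPolynomial.eval ![0, 0] g = 0)
    (hx0 : MvPolynomial.eval ![0, 0] (MvPolynomial.pderiv 0 g) = 0) {K c : ℝ} (hK : 0 ≤ K)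
    (hc : 0 < c)
    (hcone : ∀ᶠ w : ℂ × ℂ in 𝓝 0,
      MvPolynomial.eval ![w.1, w.2] (MvPolynomial.pderiv 0 g) = 0 → ‖w.1‖ ≤ K * ‖w.2‖)
    (hpolar : ∀ᶠ w : ℂ × ℂ in 𝓝 0,
      MvPolynomial.eval ![w.1, w.2] (MvPolynomial.pderiv 0 g) = 0 →
        MvPolynomial.eval ![w.1, w.2] (MvPolynomial.pderiv 1 g) = 0 ∨
          c * ‖w.2‖ ^ D ≤ ‖MvPolynomial.eval ![w.1, w.2] (MvPolynomial.pderiv 1 g)‖) :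
    ∃ C : ℝ, 0 ≤ C ∧ ∀ᶠ w : ℂ × ℂ in 𝓝 0,
      ‖MvPolynomial.eval ![w.1, w.2] g‖ ^ D ≤
        C * (‖MvPolynomial.eval ![w.1, w.2] (MvPolynomial.pderiv 0 g)‖ +
          ‖MvPolynomial.eval ![w.1, w.2] (MvPolynomial.pderiv 1 g)‖) ^ (D + 1) := by
  obtain ⟨N, hN, s, hs, b, hb, hsplit⟩ := exists_polar_branches ha hdeg hlead
  have hfst : Tendsto (fun w : ℂ × ℂ => w.1) (𝓝 0) (𝓝 0) := continuous_fst.tendsto _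
  have hsnd : Tendsto (fun w : ℂ × ℂ => w.2) (𝓝 0) (𝓝 0) := continuous_snd.tendsto _
  have hroot : ∀ γ ∈ s, ∀ᶠ t in 𝓝 0,
      MvPolynomial.eval ![γ t, t ^ N] (MvPolynomial.pderiv 0 g) = 0 := by
    intro γ hγ
    filter_upwards [hsplit] with t ht
    rw [← eval_fiber, ← derivative_fiber, ht, eval_mul, eval_list_prod, List.prod_eq_zero,
      mul_zero]
    simp only [List.map_map, List.mem_map]
    exact ⟨γ, hγ, by simp⟩
  obtain ⟨γ₁, hγ₁, hγ₁0⟩ : ∃ γ ∈ s, γ 0 = 0 := by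
    have h1 := congrArg (eval 0) hsplit.self_of_nhds
    rw [derivative_fiber, eval_fiber, zero_pow hN, hx0, eval_mul, eval_C, eval_list_prod] at h1
    have h2 := List.prod_eq_zero_iff.1 ((mul_eq_zero.1 h1.symm).resolve_left hb)
    simp only [List.map_map, List.mem_map, Function.comp_apply, eval_sub, eval_X, eval_C,
      zero_sub, neg_eq_zero] at h2
    exact h2
  have hbranch : ∀ γ ∈ s, ∃ C : ℝ, 0 ≤ C ∧ ∀ᶠ w : ℂ × ℂ in 𝓝 0,
      (∀ δ ∈ s, ‖w.1 - γ w.2‖ ≤ ‖w.1 - δ w.2‖) →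
      ‖MvPolynomial.eval ![w.1, w.2 ^ N] g‖ ^ D ≤
        C * (‖MvPolynomial.eval ![w.1, w.2 ^ N] (MvPolynomial.pderiv 0 g)‖ +
          ‖MvPolynomial.eval ![w.1, w.2 ^ N] (MvPolynomial.pderiv 1 g)‖) ^ (D + 1) := by
    intro γ hγ
    have hγc : Tendsto (fun w : ℂ × ℂ => w.1 - γ w.2) (𝓝 0) (𝓝 (0 - γ 0)) :=
      hfst.sub ((hs γ hγ).continuousAt.tendsto.comp hsnd)
    by_cases hγ0 : γ 0 = 0
    · have hM : (0 : ℝ) ≤ 3 ^ s.length := by positivity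
      obtain ⟨A, hA, hAb⟩ := exists_polar_branch_bound hdeg hN (hs γ hγ) hγ0 h0 (hroot γ hγ) hM
      obtain ⟨C, hC, hCb⟩ := exists_pow_le_mul_pow_succ_of_polar_bound (n := n) hnD hA hK
        (div_nonneg hM (norm_nonneg a)) hc
      have hcurve : Tendsto (fun t => (γ t, t ^ N)) (𝓝 0) (𝓝 (0 : ℂ × ℂ)) := by
        have h1 := (hs γ hγ).continuousAt.tendsto
        rw [hγ0] at h1
        exact h1.prodMk_nhds (tendsto_pow_nhds_zero hN)
      have hsmall : ∀ᶠ w : ℂ × ℂ in 𝓝 0, ‖w.1 - γ w.2‖ < 1 :=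
        hγc.norm.eventually_lt_const (by simp [hγ0])
      refine ⟨C, hC, ?_⟩
      filter_upwards [hsnd.eventually hAb, hsnd.eventually hsplit, hsmall,
        hsnd.eventually (hroot γ hγ), hsnd.eventually (hcurve.eventually hcone),
        hsnd.eventually (hcurve.eventually hpolar)]
        with w hAb hsplit hsmall hroot hcone hpolar hnear
      have hterm : ∀ k, ‖(taylor (γ w.2) (fiber g (w.2 ^ N))).coeff (k + 1)‖ *
          ‖w.1 - γ w.2‖ ^ k ≤
          3 ^ s.length * ‖MvPolynomial.eval ![w.1, w.2 ^ N] (MvPolynomial.pderiv 0 g)‖ := by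
        intro k
        have := norm_taylor_coeff_fiber_mul_pow_le (p := fiber g (w.2 ^ N)) (b := b)
          (s := s.map fun γ => γ w.2) (x := w.1) (γ := γ w.2)
          (by rw [hsplit, List.map_map]; rfl) (by simpa using hnear) k
        rwa [derivative_fiber, eval_fiber, List.length_map] at this
      have hξ := hAb (w.1 - γ w.2)
      simp only [add_sub_cancel] at hξ
      obtain ⟨h1, h2⟩ := hξ hterm
      refine hCb _ _ _ ‖MvPolynomial.eval ![γ w.2, w.2 ^ N] (MvPolynomial.pderiv 1 g)‖ ‖w.2 ^ N‖
        ‖w.1 - γ w.2‖ ‖γ w.2‖ (norm_nonneg _) (norm_nonneg _) (norm_nonneg _) (norm_nonneg _)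
        (norm_nonneg _) (norm_nonneg _) hsmall.le ?_ (hcone hroot) ?_ h1 ?_
      · have h3 := hterm n
        have h4 : (taylor (γ w.2) (fiber g (w.2 ^ N))).coeff (n + 1) = a := by
          have h5 : (fiber g (w.2 ^ N)).natDegree = n + 1 :=
            le_antisymm (hdeg _) (le_natDegree_of_ne_zero (by rw [hlead]; exact ha))
          rw [← h5, coeff_taylor_natDegree, leadingCoeff, h5, hlead]
        rw [h4] at h3
        rw [div_mul_eq_mul_div, le_div_iff₀ (norm_pos_iff.2 ha), mul_comm]
        exact h3
      · rw [norm_eq_zero]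
        exact hpolar hroot
      · refine le_trans ?_ (add_le_add_right h2 _)
        rw [← mul_add]
        refine mul_le_mul_of_nonneg_left ?_ (norm_nonneg _)
        rw [norm_sub_rev]
        exact norm_le_insert' _ _
    · refine ⟨0, le_rfl, ?_⟩
      have h1 : Tendsto (fun w : ℂ × ℂ => w.1 - γ₁ w.2) (𝓝 0) (𝓝 (0 - γ₁ 0)) :=
        hfst.sub ((hs γ₁ hγ₁).continuousAt.tendsto.comp hsnd)
      filter_upwards [h1.norm.eventually_lt hγc.norm (by simpa [hγ₁0] using hγ0)] with w hw hnear
      exact absurd (hnear γ₁ hγ₁) hw.not_ge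
  choose! C hC hCb using hbranch
  have hall : ∀ᶠ w : ℂ × ℂ in 𝓝 0, ∀ γ ∈ s, (∀ δ ∈ s, ‖w.1 - γ w.2‖ ≤ ‖w.1 - δ w.2‖) →
      ‖MvPolynomial.eval ![w.1, w.2 ^ N] g‖ ^ D ≤
        C γ * (‖MvPolynomial.eval ![w.1, w.2 ^ N] (MvPolynomial.pderiv 0 g)‖ +
          ‖MvPolynomial.eval ![w.1, w.2 ^ N] (MvPolynomial.pderiv 1 g)‖) ^ (D + 1) := by
    classical
    have := (Finset.eventually_all s.toFinset).2 fun γ hγ => hCb γ (List.mem_toFinset.1 hγ)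
    simpa using this
  classical
  refine ⟨∑ γ ∈ s.toFinset, C γ,
    Finset.sum_nonneg fun γ hγ => hC γ (List.mem_toFinset.1 hγ), ?_⟩
  obtain ⟨ε, hε, hball⟩ := Metric.eventually_nhds_iff_ball.1 hall
  have hεN : 0 < min ε (ε ^ N) := lt_min hε (pow_pos hε N)
  filter_upwards [Metric.ball_mem_nhds 0 hεN] with w hw
  rw [mem_ball_zero_iff, Prod.norm_def, max_lt_iff] at hw
  obtain ⟨t, ht⟩ := IsAlgClosed.exists_pow_nat_eq w.2 (Nat.pos_of_ne_zero hN)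
  have htε : ‖t‖ < ε := by
    refine lt_of_pow_lt_pow_left₀ N hε.le ?_
    rw [← norm_pow, ht]
    exact hw.2.trans_le (min_le_right _ _)
  have hmem : (w.1, t) ∈ Metric.ball (0 : ℂ × ℂ) ε := by
    rw [mem_ball_zero_iff, Prod.norm_def, max_lt_iff]
    exact ⟨hw.1.trans_le (min_le_left _ _), htε⟩
  obtain ⟨γ, hγ, hmin⟩ := s.toFinset.exists_min_image (fun γ => ‖w.1 - γ t‖)
    ⟨γ₁, List.mem_toFinset.2 hγ₁⟩
  have hfin := hball _ hmem γ (List.mem_toFinset.1 hγ) fun δ hδ => hmin δ (List.mem_toFinset.2 hδ)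
  simp only [ht] at hfin
  refine hfin.trans (mul_le_mul_of_nonneg_right ?_ (by positivity))
  exact Finset.single_le_sum (f := C) (fun δ hδ => hC δ (List.mem_toFinset.1 hδ)) hγ

lemma MvPolynomial.two_mul_finrank_restrictTotalDegree (K : Type*) [Field K] (m : ℕ) :
    2 * Module.finrank K (restrictTotalDegree (Fin 2) K m) = (m + 1) * (m + 2) := by
  have h1 : Module.finrank K (restrictTotalDegree (Fin 2) K m) =
      Nat.card {s : Fin 2 →₀ ℕ | (s.sum fun _ e => e) ≤ m} :=
    Module.finrank_eq_nat_card_basis (basisRestrictSupport K _)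
  have h2 : {s : Fin 2 →₀ ℕ | (s.sum fun _ e => e) ≤ m} =
      ((Finset.range (m + 1)).biUnion fun k => Finset.finsuppAntidiag Finset.univ k :
        Finset (Fin 2 →₀ ℕ)) := by
    ext s
    simp [Finset.mem_finsuppAntidiag, Finsupp.sum_fintype]
  rw [h1, h2, Nat.card_coe_set_eq, Set.ncard_coe_finset, Finset.card_biUnion]
  · simp only [Finset.card_finsuppAntidiag_nat_eq_choose, Finset.card_univ, Fintype.card_fin]
    clear h1 h2
    have h3 : ∀ x, (2 + x - 1).choose x = x + 1 := fun x => by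
      rw [show 2 + x - 1 = x + 1 by omega, Nat.choose_succ_self_right]
    simp only [h3]
    induction m with
    | zero => simp
    | succ m ih =>
      rw [Finset.sum_range_succ, mul_add, ih]
      ring
  · intro i _ j _ hij
    rw [Function.onFun, Finset.disjoint_left]
    intro s hs hs'
    simp only [Finset.mem_finsuppAntidiag] at hs hs'
    exact hij (hs.1.symm.trans hs'.1)

lemma MvPolynomial.totalDegree_aeval_X_le {K σ : Type*} [Field K] (i : σ) (R : K[X]) :
    (Polynomial.aeval (X i : MvPolynomial σ K) R).totalDegree ≤ R.natDegree := by
  rw [Polynomial.aeval_eq_sum_range]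
  refine totalDegree_finsetSum_le fun k hk => ?_
  refine (totalDegree_smul_le _ _).trans ((totalDegree_pow _ _).trans ?_)
  rw [totalDegree_X, mul_one]
  exact Nat.lt_succ_iff.1 (Finset.mem_range.1 hk)

/-- A weak form of the **Bézout theorem**: the ideal generated by two coprime polynomials in two
variables contains a nonzero polynomial in the second variable whose degree is at most the
product of the degrees. -/
theorem MvPolynomial.exists_aeval_X_eq_of_isRelPrime {K : Type*} [Field K]
    {A B : MvPolynomial (Fin 2) K} (hB : B ≠ 0) (h : IsRelPrime A B) :
    ∃ R : K[X], R ≠ 0 ∧ R.natDegree ≤ A.totalDegree * B.totalDegree ∧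
      ∃ u w : MvPolynomial (Fin 2) K,
          Polynomial.aeval (X 1 : MvPolynomial (Fin 2) K) R = u * A + w * B := by
  set a := A.totalDegree with ha
  set b := B.totalDegree with hb
  let T := restrictTotalDegree (Fin 2) K
  let L := degreeLT K (a * b + 1)
  let Φ : (T (b + a * b) × T (a + a * b)) × L →ₗ[K] MvPolynomial (Fin 2) K :=
    (((LinearMap.mulRight K A).comp (T _).subtype).coprod
      ((LinearMap.mulRight K B).comp (T _).subtype)).coprod
      (-(Polynomial.aeval (X 1 : MvPolynomial (Fin 2) K)).toLinearMap.comp L.subtype)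
  have hΦ : ∀ u w R, Φ ((u, w), R) = u.1 * A + w.1 * B - Polynomial.aeval (X 1) R.1 := by
    intro u w R
    simp [Φ, sub_eq_add_neg]
  have hL : Module.finrank K L = a * b + 1 := by
    rw [(degreeLTEquiv K (a * b + 1)).finrank_eq, Module.finrank_fin_fun]
  have hLdeg : ∀ R : L, R.1.natDegree ≤ a * b := by
    intro R
    by_cases hR : R.1 = 0
    · simp [hR]
    · exact Nat.lt_succ_iff.1 ((natDegree_lt_iff_degree_lt hR).2 (mem_degreeLT.1 R.2))
  have hT := two_mul_finrank_restrictTotalDegree K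
  have hfinL : FiniteDimensional K L := Module.Finite.equiv (degreeLTEquiv K (a * b + 1)).symm
  have hrange : Φ.range ≤ T (a + b + a * b) := by
    rintro _ ⟨⟨⟨u, w⟩, R⟩, rfl⟩
    rw [hΦ, mem_restrictTotalDegree]
    have hu := (mem_restrictTotalDegree _ _ _).1 u.2
    have hw := (mem_restrictTotalDegree _ _ _).1 w.2
    have h1 := totalDegree_mul u.1 A
    have h2 := totalDegree_mul w.1 B
    have h3 := totalDegree_aeval_X_le (1 : Fin 2) R.1
    have h4 := hLdeg R
    refine (totalDegree_sub _ _).trans (max_le ((totalDegree_add _ _).trans (max_le ?_ ?_)) ?_) <;>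
    omega
  by_contra! hno
  have hker : Module.finrank K Φ.ker ≤ Module.finrank K (T (a * b)) := by
    have hu : ∀ v : T (a * b), v.1 * B ∈ T (b + a * b) := fun v => by
      have hv := (mem_restrictTotalDegree _ _ _).1 v.2
      have := totalDegree_mul v.1 B
      rw [mem_restrictTotalDegree]
      omega
    have hw : ∀ v : T (a * b), -(v.1 * A) ∈ T (a + a * b) := fun v => by
      have hv := (mem_restrictTotalDegree _ _ _).1 v.2
      have := totalDegree_mul v.1 A
      rw [mem_restrictTotalDegree, totalDegree_neg]
      omega
    let Ψ : T (a * b) →ₗ[K] (T (b + a * b) × T (a + a * b)) × L :=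
      ((((LinearMap.mulRight K B).comp (T _).subtype).codRestrict _ hu).prod
        ((-(LinearMap.mulRight K A).comp (T _).subtype).codRestrict _ hw)).prod 0
    refine (Submodule.finrank_mono ?_).trans (LinearMap.finrank_range_le Ψ)
    rintro ⟨⟨u, w⟩, R⟩ hmem
    rw [LinearMap.mem_ker, hΦ, sub_eq_zero] at hmem
    have hR : R = 0 := by
      by_contra hR
      exact hno R.1 (by simpa using hR) (hLdeg R) u.1 w.1 hmem.symm
    rw [hR, ZeroMemClass.coe_zero, map_zero] at hmem
    obtain ⟨v, hv⟩ : B ∣ u.1 := by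
      refine h.symm.dvd_of_dvd_mul_right (Dvd.intro_left (-w.1) ?_)
      linear_combination -hmem
    have hwv : w.1 = -(v * A) := by
      refine mul_right_cancel₀ hB ?_
      rw [hv] at hmem
      linear_combination hmem
    have hvT : v ∈ T (a * b) := by
      rw [mem_restrictTotalDegree]
      by_cases hv0 : v = 0
      · simp [hv0]
      · have h1 := (mem_restrictTotalDegree _ _ _).1 u.2
        rw [hv, totalDegree_mul_of_isDomain hB hv0] at h1
        omega
    exact ⟨⟨v, hvT⟩, Prod.ext (Prod.ext (Subtype.ext ((mul_comm v B).trans hv.symm))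
      (Subtype.ext hwv.symm)) hR.symm⟩
  have hrk := Φ.finrank_range_add_finrank_ker
  have hle := Submodule.finrank_mono hrange
  rw [Module.finrank_prod, Module.finrank_prod, hL] at hrk
  have t1 := hT (a * b)
  have t2 := hT (b + a * b)
  have t3 := hT (a + a * b)
  have t4 := hT (a + b + a * b)
  nlinarith

lemma UniqueFactorizationMonoid.exists_mul_isRelPrime {R : Type*} [CommMonoidWithZero R]
    [UniqueFactorizationMonoid R] {a : R} (ha : a ≠ 0) (b : R) :
    ∃ (g c : R) (k : ℕ), a = g * c ∧ g ∣ b ^ k ∧ IsRelPrime c b := by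
  induction a using UniqueFactorizationMonoid.induction_on_prime with
  | h₁ => exact absurd rfl ha
  | h₂ x hx => exact ⟨1, x, 0, (one_mul x).symm, one_dvd _, hx.isRelPrime_left⟩
  | h₃ a p ha0 hp ih =>
    obtain ⟨g, c, k, rfl, hg, hc⟩ := ih ha0
    by_cases hpb : p ∣ b
    · exact ⟨p * g, c, k + 1, (mul_assoc _ _ _).symm, by
        rw [pow_succ']; exact mul_dvd_mul hpb hg, hc⟩
    · refine ⟨g, p * c, k, mul_left_comm _ _ _, hg, IsRelPrime.mul_left ?_ hc⟩
      exact (hp.irreducible.isRelPrime_iff_not_dvd).2 hpb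

lemma Polynomial.exists_eventually_mul_norm_pow_le {R : ℂ[X]} (hR : R ≠ 0) {D : ℕ}
    (hD : R.natDegree ≤ D) : ∃ c : ℝ, 0 < c ∧ ∀ᶠ y in 𝓝 0, c * ‖y‖ ^ D ≤ ‖R.eval y‖ := by
  obtain ⟨Q, hQ, hnd⟩ := exists_eq_pow_rootMultiplicity_mul_and_not_dvd R hR 0
  rw [C_0, sub_zero] at hQ hnd
  have hQ0 : 0 < ‖Q.eval 0‖ := by
    rw [norm_pos_iff]
    rwa [X_dvd_iff, coeff_zero_eq_eval_zero] at hnd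
  refine ⟨‖Q.eval 0‖ / 2, half_pos hQ0, ?_⟩
  filter_upwards [Metric.ball_mem_nhds (0 : ℂ) one_pos,
    Q.continuous.norm.continuousAt.eventually_const_le (half_lt_self hQ0)] with y hy hQy
  rw [hQ, eval_mul, eval_pow, eval_X, norm_mul, norm_pow, mul_comm]
  refine mul_le_mul ?_ hQy (by positivity) (by positivity)
  exact pow_le_pow_of_le_one (norm_nonneg _) (mem_ball_zero_iff.1 hy).le
    (le_trans (by simpa using natDegree_le_of_dvd (pow_rootMultiplicity_dvd R 0) hR) hD)

/-- On the curve `P = 0`, the polynomial `Q` is zero or bounded below by a power of `y`. -/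
theorem MvPolynomial.exists_eventually_eval_eq_zero_or_mul_norm_pow_le
    {P Q : MvPolynomial (Fin 2) ℂ} (hP : P ≠ 0) {D : ℕ} (hD : P.totalDegree * Q.totalDegree ≤ D) :
    ∃ c : ℝ, 0 < c ∧ ∀ᶠ w : ℂ × ℂ in 𝓝 0, eval ![w.1, w.2] P = 0 →
      eval ![w.1, w.2] Q = 0 ∨ c * ‖w.2‖ ^ D ≤ ‖eval ![w.1, w.2] Q‖ := by
  by_cases hQ : Q = 0
  · exact ⟨1, one_pos, by simp [hQ]⟩
  obtain ⟨G, A, k, rfl, hG, hAQ⟩ := UniqueFactorizationMonoid.exists_mul_isRelPrime hP Q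
  have hG0 := left_ne_zero_of_mul hP
  have hA0 := right_ne_zero_of_mul hP
  obtain ⟨R, hR, hRdeg, u, v, huv⟩ := exists_aeval_X_eq_of_isRelPrime hQ hAQ
  rw [totalDegree_mul_of_isDomain hG0 hA0] at hD
  have hRD : R.natDegree ≤ D :=
    hRdeg.trans ((Nat.mul_le_mul_right _ (Nat.le_add_left _ _)).trans hD)
  obtain ⟨c, hc, hcb⟩ := exists_eventually_mul_norm_pow_le hR hRD
  have hcont : Continuous fun w : ℂ × ℂ => eval ![w.1, w.2] v :=
    (continuous_eval v).comp (by fun_prop)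
  set M := ‖eval ![(0 : ℂ), 0] v‖ + 1 with hM
  have hM0 : 0 < M := by positivity
  refine ⟨c / M, div_pos hc hM0, ?_⟩
  filter_upwards [(continuous_snd.tendsto (0 : ℂ × ℂ)).eventually hcb,
    hcont.norm.continuousAt.eventually_le_const (lt_add_one _)] with w hw hvM hGA
  rw [map_mul, mul_eq_zero] at hGA
  rcases hGA with hGw | hAw
  · left
    have := map_dvd (eval ![w.1, w.2]) hG
    rw [hGw, zero_dvd_iff, map_pow] at this
    exact eq_zero_of_pow_eq_zero this
  · right
    have h1 := congrArg (eval ![w.1, w.2]) huv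
    have h2 : eval ![w.1, w.2] (Polynomial.aeval (X 1 : MvPolynomial (Fin 2) ℂ) R) =
        R.eval w.2 := by
      have h3 : (eval ![w.1, w.2]).comp C = RingHom.id ℂ := RingHom.ext fun x => eval_C x
      rw [Polynomial.aeval_def, Polynomial.hom_eval₂, algebraMap_eq, h3, eval_X]
      rfl
    rw [h2, map_add, map_mul, hAw, mul_zero, zero_add, map_mul] at h1
    rw [h1, norm_mul] at hw
    rw [div_mul_eq_mul_div, div_le_iff₀ hM0, mul_comm _ M]
    exact hw.trans (mul_le_mul_of_nonneg_right hvM (norm_nonneg _))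

lemma natDegree_fiber_le (g : MvPolynomial (Fin 2) ℂ) (y : ℂ) :
    (fiber g y).natDegree ≤ g.totalDegree := by
  unfold fiber
  rw [MvPolynomial.aeval_def, MvPolynomial.eval₂_eq']
  refine natDegree_sum_le_of_forall_le _ _ fun s hs => ?_
  have h := MvPolynomial.le_totalDegree hs
  rw [Finsupp.sum_fintype _ _ (by simp), Fin.sum_univ_two] at h
  simp only [Fin.prod_univ_two, Matrix.cons_val_zero, Matrix.cons_val_one,
    Polynomial.algebraMap_apply, Algebra.algebraMap_self, RingHom.id_apply, ← C_pow]
  refine (natDegree_C_mul_le _ _).trans ((natDegree_mul_C_le _ _).trans ?_)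
  rw [natDegree_X_pow]
  omega

lemma coeff_fiber_of_totalDegree_le {g : MvPolynomial (Fin 2) ℂ} {m : ℕ}
    (hg : g.totalDegree ≤ m) (y : ℂ) :
    (fiber g y).coeff m =
      MvPolynomial.eval ![1, 0] (MvPolynomial.homogeneousComponent m g) := by
  unfold fiber
  rw [MvPolynomial.aeval_def, MvPolynomial.eval₂_eq', MvPolynomial.homogeneousComponent_apply,
    map_sum, finsetSum_coeff, Finset.sum_filter]
  refine Finset.sum_congr rfl fun s hs => ?_
  have h := (MvPolynomial.le_totalDegree hs).trans hg
  rw [Finsupp.sum_fintype _ _ (by simp), Fin.sum_univ_two] at h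
  rw [Finsupp.degree_eq_sum, Fin.sum_univ_two, MvPolynomial.eval_monomial,
    Finsupp.prod_fintype _ _ (by simp)]
  simp only [Fin.prod_univ_two, Matrix.cons_val_zero, Matrix.cons_val_one,
    Polynomial.algebraMap_apply, Algebra.algebraMap_self, RingHom.id_apply, ← C_pow, coeff_C_mul,
    coeff_mul_C, coeff_X_pow]
  rcases Nat.eq_zero_or_pos (s 1) with h1 | h1
  · simp [h1, eq_comm]
  · rw [if_neg (by omega)]
    simp [h1.ne']

lemma MvPolynomial.IsHomogeneous.eval_smul_eq_pow_mul {σ R : Type*} [CommSemiring R]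
    {p : MvPolynomial σ R} {k : ℕ} (hp : p.IsHomogeneous k) (c : R) (z : σ → R) :
    eval (c • z) p = c ^ k * eval z p := by
  rw [eval_eq, eval_eq, Finset.mul_sum]
  refine Finset.sum_congr rfl fun s hs => ?_
  have h : ∑ i ∈ s.support, s i = k := by
    rw [← Finsupp.degree_apply, Finsupp.degree_eq_weight_one]
    exact hp (mem_support_iff.mp hs)
  simp only [Pi.smul_apply, smul_eq_mul, mul_pow, Finset.prod_mul_distrib,
    Finset.prod_pow_eq_pow_sum]
  rw [h]
  ring

lemma MvPolynomial.homogeneousComponent_aeval {σ τ R : Type*} [CommSemiring R]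
    {φ : σ → MvPolynomial τ R} (hφ : ∀ i, (φ i).IsHomogeneous 1) (p : MvPolynomial σ R) (k : ℕ) :
    homogeneousComponent k (aeval φ p) = aeval φ (homogeneousComponent k p) := by
  have h : ∀ j, (aeval φ (homogeneousComponent j p)).IsHomogeneous j := fun j => by
    simpa using (homogeneousComponent_isHomogeneous j p).aeval φ hφ
  conv_lhs => rw [← sum_homogeneousComponent p, map_sum, map_sum]
  simp only [fun j => homogeneousComponent_of_mem (m := k) (h j)]
  simp only [Finset.sum_ite_eq, Finset.mem_range]
  split_ifs with hk
  · rfl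
  · rw [homogeneousComponent_eq_zero _ _ (by omega), map_zero]

lemma MvPolynomial.homogeneousComponent_totalDegree_ne_zero {σ R : Type*} [CommSemiring R]
    {p : MvPolynomial σ R} (hp : p ≠ 0) : homogeneousComponent p.totalDegree p ≠ 0 := by
  obtain ⟨s, hs, h⟩ := p.support.exists_mem_eq_sup (support_nonempty.mpr hp) Finsupp.degree
  intro h0
  have := congrArg (coeff s) h0
  rw [coeff_homogeneousComponent, if_pos] at this
  · exact mem_support_iff.mp hs this
  · rw [← h]
    rfl


lemma MvPolynomial.totalDegree_pderiv_le {σ R : Type*} [CommSemiring R] (i : σ)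
    (p : MvPolynomial σ R) : (pderiv i p).totalDegree ≤ p.totalDegree - 1 := by
  conv_lhs => rw [← sum_homogeneousComponent p, map_sum]
  refine totalDegree_finsetSum_le fun k hk => ?_
  refine ((homogeneousComponent_isHomogeneous k p).pderiv.totalDegree_le).trans ?_
  rw [Finset.mem_range] at hk
  omega

/-- Near the origin, the polar curve stays in a cone around the second axis as soon as the
initial form does not vanish on the first axis. -/
lemma eventually_norm_le_of_pderiv_eq_zero {g : MvPolynomial (Fin 2) ℂ} {ν : ℕ} (hν : 1 ≤ ν)
    (hlow : ∀ k < ν, MvPolynomial.homogeneousComponent k g = 0)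
    (hinit : MvPolynomial.eval ![1, 0] (MvPolynomial.homogeneousComponent ν g) ≠ 0) :
    ∃ K : ℝ, 0 ≤ K ∧ ∀ᶠ w : ℂ × ℂ in 𝓝 0,
      MvPolynomial.eval ![w.1, w.2] (MvPolynomial.pderiv 0 g) = 0 → ‖w.1‖ ≤ K * ‖w.2‖ := by
  set G := fun k => MvPolynomial.pderiv 0 (MvPolynomial.homogeneousComponent k g) with hG
  set N := Finset.Icc ν g.totalDegree with hN
  set H : ℂ × ℂ → ℂ := fun w =>
    ∑ k ∈ N, w.1 ^ (k - ν) * MvPolynomial.eval ![1, w.2] (G k) with hH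
  have hsum : MvPolynomial.pderiv 0 g = ∑ k ∈ N, G k := by
    conv_lhs => rw [← MvPolynomial.sum_homogeneousComponent g, map_sum]
    symm
    refine Finset.sum_subset (fun k hk => ?_) fun k _ hk => ?_
    · simp only [hN, Finset.mem_Icc, Finset.mem_range] at hk ⊢
      omega
    · rcases lt_or_ge k ν with h | h
      · simp only [hG, hlow k h, map_zero]
      · simp only [hG]
        rw [MvPolynomial.homogeneousComponent_eq_zero _ _ (by grind), map_zero]
  have hfac : ∀ x t : ℂ, MvPolynomial.eval ![x, x * t] (MvPolynomial.pderiv 0 g) =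
      x ^ (ν - 1) * H (x, t) := by
    intro x t
    rw [hsum, map_sum, hH, Finset.mul_sum]
    refine Finset.sum_congr rfl fun k hk => ?_
    have h1 : ![x, x * t] = x • ![1, t] := by simp
    rw [h1, (MvPolynomial.homogeneousComponent_isHomogeneous k g).pderiv.eval_smul_eq_pow_mul,
      ← mul_assoc, ← pow_add]
    simp only [hN, Finset.mem_Icc] at hk
    congr 2
    omega
  have hνN : ν ∈ N := by
    rw [hN, Finset.mem_Icc]
    refine ⟨le_rfl, not_lt.mp fun h => hinit ?_⟩
    rw [MvPolynomial.homogeneousComponent_eq_zero _ _ h, map_zero]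
  have hH0 : H 0 ≠ 0 := by
    have h1 : H 0 = MvPolynomial.eval ![1, 0] (G ν) := by
      simp only [hH, Prod.fst_zero, Prod.snd_zero]
      rw [Finset.sum_eq_single ν]
      · simp
      · intro k hk hkν
        simp only [hN, Finset.mem_Icc] at hk
        rw [zero_pow (by omega), zero_mul]
      · exact fun h => absurd hνN h
    have h2 := congrArg (MvPolynomial.eval ![(1 : ℂ), 0])
      (MvPolynomial.homogeneousComponent_isHomogeneous ν g).sum_X_mul_pderiv
    simp only [Fin.sum_univ_two, map_add, map_mul, MvPolynomial.eval_X, Matrix.cons_val_zero,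
      Matrix.cons_val_one, one_mul, zero_mul, add_zero, nsmul_eq_mul, map_natCast] at h2
    rw [h1, hG, h2]
    exact mul_ne_zero (Nat.cast_ne_zero.mpr (by omega)) hinit
  have hHc : Continuous H := by
    refine continuous_finsetSum _ fun k _ => (continuous_fst.pow _).mul ?_
    refine (MvPolynomial.continuous_eval _).comp (continuous_pi fun i => ?_)
    fin_cases i
    · exact continuous_const
    · exact continuous_snd
  obtain ⟨η, hη, hball⟩ := Metric.eventually_nhds_iff.mp (hHc.continuousAt.eventually_ne hH0)
  refine ⟨η⁻¹, inv_nonneg.mpr hη.le, ?_⟩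
  filter_upwards [Metric.ball_mem_nhds (0 : ℂ × ℂ) hη] with w hw h0
  by_contra! hcon
  have hpos : 0 < ‖w.1‖ := (by positivity : 0 ≤ η⁻¹ * ‖w.2‖).trans_lt hcon
  have hne : w.1 ≠ 0 := norm_pos_iff.mp hpos
  have h1 := hfac w.1 (w.2 / w.1)
  rw [mul_div_cancel₀ _ hne, h0] at h1
  refine mul_ne_zero (pow_ne_zero _ hne) (hball ?_) h1.symm
  rw [Metric.mem_ball, dist_zero_right] at hw
  rw [dist_zero_right, Prod.norm_mk, max_lt_iff, norm_div, div_lt_iff₀ hpos]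
  refine ⟨(norm_fst_le w).trans_lt hw, ?_⟩
  rwa [inv_mul_lt_iff₀ hη] at hcon

/-- The Łojasiewicz gradient inequality with the effective exponent, in coordinates where neither
the leading form nor the initial form vanishes on the first axis. -/
lemma exists_norm_pow_le_mul_pow_succ_of_forms_ne_zero {g : MvPolynomial (Fin 2) ℂ} {n ν : ℕ}
    (hdeg : g.totalDegree ≤ n + 1) (hν : 1 ≤ ν)
    (hlead : MvPolynomial.eval ![1, 0] (MvPolynomial.homogeneousComponent (n + 1) g) ≠ 0)
    (hlow : ∀ k < ν, MvPolynomial.homogeneousComponent k g = 0)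
    (hinit : MvPolynomial.eval ![1, 0] (MvPolynomial.homogeneousComponent ν g) ≠ 0)
    (h0 : MvPolynomial.eval ![0, 0] g = 0)
    (hx0 : MvPolynomial.eval ![0, 0] (MvPolynomial.pderiv 0 g) = 0) :
    ∃ C : ℝ, 0 ≤ C ∧ ∀ᶠ w : ℂ × ℂ in 𝓝 0,
      ‖MvPolynomial.eval ![w.1, w.2] g‖ ^ (n ^ 2) ≤
        C * (‖MvPolynomial.eval ![w.1, w.2] (MvPolynomial.pderiv 0 g)‖ +
          ‖MvPolynomial.eval ![w.1, w.2] (MvPolynomial.pderiv 1 g)‖) ^ (n ^ 2 + 1) := by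
  have hne : MvPolynomial.pderiv 0 g ≠ 0 := by
    intro h
    have h1 := derivative_fiber g 0
    rw [h] at h1
    have h2 := congrArg (coeff · n) h1
    simp only [coeff_derivative, coeff_fiber_of_totalDegree_le hdeg] at h2
    refine mul_ne_zero hlead (Nat.cast_add_one_ne_zero n) (h2.trans ?_)
    simp [fiber]
  obtain ⟨K, hK, hcone⟩ := eventually_norm_le_of_pderiv_eq_zero hν hlow hinit
  have hD : (MvPolynomial.pderiv 0 g).totalDegree * (MvPolynomial.pderiv 1 g).totalDegree ≤
      n ^ 2 := by
    have h : ∀ i, (MvPolynomial.pderiv i g).totalDegree ≤ n := fun i =>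
      (MvPolynomial.totalDegree_pderiv_le i g).trans (by omega)
    rw [sq]
    exact Nat.mul_le_mul (h 0) (h 1)
  obtain ⟨c, hc, hpolar⟩ :=
    MvPolynomial.exists_eventually_eval_eq_zero_or_mul_norm_pow_le hne hD
  exact exists_norm_pow_le_mul_pow_succ (Nat.le_self_pow two_ne_zero n) hlead
    (fun y => (natDegree_fiber_le g y).trans hdeg)
    (fun y => coeff_fiber_of_totalDegree_le hdeg y) h0 hx0 hK hc hcone hpolar

/-- The pullback of a polynomial in two variables under `(x, y) ↦ (x, s * x + y)`. -/
noncomputable def shear (s : ℂ) : MvPolynomial (Fin 2) ℂ →ₐ[ℂ] MvPolynomial (Fin 2) ℂ :=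
  MvPolynomial.aeval ![MvPolynomial.X 0, MvPolynomial.C s * MvPolynomial.X 0 + MvPolynomial.X 1]

lemma shear_X_zero (s : ℂ) : shear s (MvPolynomial.X 0) = MvPolynomial.X 0 := by
  simp [shear]

lemma shear_X_one (s : ℂ) : shear s (MvPolynomial.X 1) =
    MvPolynomial.C s * MvPolynomial.X 0 + MvPolynomial.X 1 := by
  simp [shear]

lemma eval_shear (s : ℂ) (f : MvPolynomial (Fin 2) ℂ) (x y : ℂ) :
    MvPolynomial.eval ![x, y] (shear s f) = MvPolynomial.eval ![x, s * x + y] f := by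
  induction f using MvPolynomial.induction_on with
  | C a => simp
  | add p q hp hq => simp only [map_add, hp, hq]
  | mul_X p i hp => fin_cases i <;> simp [shear_X_zero, shear_X_one, hp]

lemma pderiv_zero_shear (s : ℂ) (f : MvPolynomial (Fin 2) ℂ) :
    MvPolynomial.pderiv 0 (shear s f) =
      shear s (MvPolynomial.pderiv 0 f) + MvPolynomial.C s * shear s (MvPolynomial.pderiv 1 f) := by
  induction f using MvPolynomial.induction_on with
  | C a => simp
  | add p q hp hq =>
    simp only [map_add, hp, hq]
    ring
  | mul_X p i hp =>
    fin_cases i <;>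
    simp [shear_X_zero, shear_X_one, hp, Derivation.leibniz,
      MvPolynomial.pderiv_X] <;> ring

lemma pderiv_one_shear (s : ℂ) (f : MvPolynomial (Fin 2) ℂ) :
    MvPolynomial.pderiv 1 (shear s f) = shear s (MvPolynomial.pderiv 1 f) := by
  induction f using MvPolynomial.induction_on with
  | C a => simp
  | add p q hp hq => simp only [map_add, hp, hq]
  | mul_X p i hp =>
    fin_cases i <;>
    simp [shear_X_zero, shear_X_one, hp, Derivation.leibniz,
      MvPolynomial.pderiv_X]

lemma homogeneousComponent_shear (s : ℂ) (f : MvPolynomial (Fin 2) ℂ) (k : ℕ) :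
    MvPolynomial.homogeneousComponent k (shear s f) =
      shear s (MvPolynomial.homogeneousComponent k f) := by
  refine MvPolynomial.homogeneousComponent_aeval (fun i => ?_) f k
  fin_cases i
  · exact MvPolynomial.isHomogeneous_X _ _
  · exact (MvPolynomial.isHomogeneous_C_mul_X _ _).add (MvPolynomial.isHomogeneous_X _ _)

lemma totalDegree_shear_le (s : ℂ) (f : MvPolynomial (Fin 2) ℂ) :
    (shear s f).totalDegree ≤ f.totalDegree := by
  conv_lhs => rw [← MvPolynomial.sum_homogeneousComponent f, map_sum]
  refine MvPolynomial.totalDegree_finsetSum_le fun k hk => ?_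
  rw [← homogeneousComponent_shear]
  refine (MvPolynomial.homogeneousComponent_isHomogeneous k _).totalDegree_le.trans ?_
  rw [Finset.mem_range] at hk
  omega

/-- The Łojasiewicz gradient inequality with the effective exponent for complex polynomials in two
variables. -/
theorem exists_norm_eval_pow_le_mul_pderiv_pow {f : MvPolynomial (Fin 2) ℂ} {n : ℕ}
    (hdeg : f.totalDegree = n + 1) (hf0 : MvPolynomial.constantCoeff f = 0) :
    ∃ C : ℝ, 0 ≤ C ∧ ∀ᶠ w : ℂ × ℂ in 𝓝 0,
      ‖MvPolynomial.eval ![w.1, w.2] f‖ ^ (n ^ 2) ≤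
        C * (‖MvPolynomial.eval ![w.1, w.2] (MvPolynomial.pderiv 0 f)‖ +
          ‖MvPolynomial.eval ![w.1, w.2] (MvPolynomial.pderiv 1 f)‖) ^ (n ^ 2 + 1) := by
  have hcont : ∀ p : MvPolynomial (Fin 2) ℂ,
      Continuous fun w : ℂ × ℂ => MvPolynomial.eval ![w.1, w.2] p := fun p => by
    refine (MvPolynomial.continuous_eval p).comp (continuous_pi fun i => ?_)
    fin_cases i
    · exact continuous_fst
    · exact continuous_snd
  have hzero : ∀ p : MvPolynomial (Fin 2) ℂ,
      MvPolynomial.eval ![0, 0] p = MvPolynomial.constantCoeff p := fun p => by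
    rw [← MvPolynomial.eval_zero]
    congr 2
    ext i
    fin_cases i <;> rfl
  set S : ℂ × ℂ → ℝ := fun w => ‖MvPolynomial.eval ![w.1, w.2] (MvPolynomial.pderiv 0 f)‖ +
    ‖MvPolynomial.eval ![w.1, w.2] (MvPolynomial.pderiv 1 f)‖ with hS
  have hSc : Continuous S := (hcont _).norm.add (hcont _).norm
  have hS0 : 0 ≤ S 0 := by positivity
  rcases hS0.lt_or_eq with hpos | hgrad
  · refine ⟨(‖MvPolynomial.eval ![0, 0] f‖ ^ (n ^ 2) + 1) / (S 0 / 2) ^ (n ^ 2 + 1), by positivity,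
      ?_⟩
    filter_upwards [((hcont f).norm.pow (n ^ 2)).continuousAt.eventually_lt_const
      (lt_add_one (‖MvPolynomial.eval ![(0 : ℂ), 0] f‖ ^ (n ^ 2))),
      hSc.continuousAt.eventually_const_lt (half_lt_self hpos)] with w h1 h2
    rw [div_mul_eq_mul_div, le_div_iff₀ (by positivity)]
    gcongr
    exact h1.le
  have hf : f ≠ 0 := by
    rintro rfl
    simp at hdeg
  have hlead : MvPolynomial.homogeneousComponent (n + 1) f ≠ 0 :=
    hdeg ▸ MvPolynomial.homogeneousComponent_totalDegree_ne_zero hf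
  have hex : ∃ k, MvPolynomial.homogeneousComponent k f ≠ 0 := ⟨_, hlead⟩
  classical
  set ν := Nat.find hex with hνdef
  have hinit : MvPolynomial.homogeneousComponent ν f ≠ 0 := Nat.find_spec hex
  have hlow : ∀ k < ν, MvPolynomial.homogeneousComponent k f = 0 := fun k hk =>
    not_not.mp (Nat.find_min hex hk)
  have hν : 1 ≤ ν := by
    refine Nat.one_le_iff_ne_zero.mpr fun h => hinit ?_
    rw [h, MvPolynomial.homogeneousComponent_zero, ← MvPolynomial.constantCoeff_eq, hf0, map_zero]
  obtain ⟨v, hv⟩ : ∃ v : Fin 2 → ℂ, MvPolynomial.eval v (MvPolynomial.homogeneousComponent (n + 1) f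
      * MvPolynomial.homogeneousComponent ν f * MvPolynomial.X 0) ≠ 0 := by
    by_contra! h
    exact mul_ne_zero (mul_ne_zero hlead hinit) (MvPolynomial.X_ne_zero 0)
      (MvPolynomial.funext fun v => (h v).trans (map_zero _).symm)
  simp only [map_mul, MvPolynomial.eval_X, mul_ne_zero_iff] at hv
  obtain ⟨⟨hv1, hv2⟩, hv0⟩ := hv
  set s := v 1 / v 0 with hs
  have hvs : v = v 0 • ![1, s] := by
    ext i
    fin_cases i
    · simp
    · simp [hs, mul_div_cancel₀ _ hv0]
  have hform : ∀ k, MvPolynomial.eval v (MvPolynomial.homogeneousComponent k f) ≠ 0 →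
      MvPolynomial.eval ![1, 0] (MvPolynomial.homogeneousComponent k (shear s f)) ≠ 0 := by
    intro k hk h
    apply hk
    rw [homogeneousComponent_shear, eval_shear, mul_one, add_zero] at h
    rw [hvs, (MvPolynomial.homogeneousComponent_isHomogeneous k f).eval_smul_eq_pow_mul, h,
      mul_zero]
  have hgrad0 : MvPolynomial.eval ![0, 0] (MvPolynomial.pderiv 0 (shear s f)) = 0 := by
    have h1 := (add_eq_zero_iff_of_nonneg (norm_nonneg _) (norm_nonneg _)).mp hgrad.symm
    simp only [Prod.fst_zero, Prod.snd_zero, norm_eq_zero] at h1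
    rw [pderiv_zero_shear, map_add, map_mul, eval_shear, eval_shear, mul_zero, add_zero, h1.1, h1.2]
    simp
  obtain ⟨C, hC, hev⟩ := exists_norm_pow_le_mul_pow_succ_of_forms_ne_zero
    ((totalDegree_shear_le s f).trans hdeg.le) hν (hform _ hv1)
    (fun k hk => by rw [homogeneousComponent_shear, hlow k hk, map_zero]) (hform _ hv2)
    (by rw [eval_shear, mul_zero, add_zero, hzero, hf0]) hgrad0
  refine ⟨C * (1 + ‖s‖) ^ (n ^ 2 + 1), by positivity, ?_⟩
  have htend : Tendsto (fun w : ℂ × ℂ => (w.1, w.2 - s * w.1)) (𝓝 0) (𝓝 0) := by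
    have : Continuous fun w : ℂ × ℂ => (w.1, w.2 - s * w.1) := by fun_prop
    simpa using! this.tendsto 0
  filter_upwards [htend.eventually hev] with w hw
  simp only [pderiv_zero_shear, pderiv_one_shear, map_add, map_mul, eval_shear,
    MvPolynomial.eval_C, add_sub_cancel] at hw
  refine hw.trans ?_
  rw [mul_assoc, ← mul_pow]
  gcongr
  refine (add_le_add_left (norm_add_le _ _) _).trans ?_
  rw [norm_mul]
  have h1 := norm_nonneg (MvPolynomial.eval ![w.1, w.2] (MvPolynomial.pderiv 0 f))
  have h2 := norm_nonneg s
  nlinarith [mul_nonneg h1 h2]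

/-- Every `RCLike` field embeds isometrically into the complex numbers. -/
lemma RCLike.exists_ringHom_complex_norm_eq (𝕜 : Type*) [RCLike 𝕜] :
    ∃ ι : 𝕜 →+* ℂ, ∀ a, ‖ι a‖ = ‖a‖ := by
  refine ⟨{ toFun := fun a => ⟨RCLike.re a, RCLike.im a⟩
            map_one' := by simp [Complex.ext_iff]
            map_mul' := fun a b => by simp [Complex.ext_iff, RCLike.mul_re, RCLike.mul_im]
            map_zero' := by simp [Complex.ext_iff]
            map_add' := fun a b => by simp [Complex.ext_iff] }, fun a => ?_⟩
  rw [← sq_eq_sq₀ (norm_nonneg _) (norm_nonneg _), ← Complex.normSq_eq_norm_sq,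
    ← RCLike.normSq_eq_def']
  simp [Complex.normSq_apply, RCLike.normSq_apply]

lemma MvPolynomial.differentiable_eval_euclideanSpace {𝕜 σ : Type*} [RCLike 𝕜] [Fintype σ]
    (f : MvPolynomial σ 𝕜) :
    Differentiable 𝕜 fun z : EuclideanSpace 𝕜 σ => eval (fun i => z i) f := by
  induction f using MvPolynomial.induction_on with
  | C a => simp
  | add p q hp hq => simpa using hp.fun_add hq
  | mul_X p i hp =>
    simp only [map_mul, eval_X]
    exact hp.fun_mul (by fun_prop)

/-- The partial derivatives of a polynomial are dominated by the norm of its gradient. -/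
lemma MvPolynomial.norm_eval_pderiv_le_norm_fderiv {𝕜 σ : Type*} [RCLike 𝕜] [Fintype σ]
    (f : MvPolynomial σ 𝕜) (i : σ) (z : EuclideanSpace 𝕜 σ) :
    ‖eval (fun j => z j) (pderiv i f)‖ ≤
      ‖fderiv 𝕜 (fun z : EuclideanSpace 𝕜 σ => eval (fun j => z j) f) z‖ := by
  classical
  set F := fun z : EuclideanSpace 𝕜 σ => eval (fun j => z j) f
  set e : EuclideanSpace 𝕜 σ := EuclideanSpace.single i 1 with he
  have hF : HasFDerivAt F (fderiv 𝕜 F z) (z + (0 : 𝕜) • e) := by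
    rw [zero_smul, add_zero]
    exact (differentiable_eval_euclideanSpace f z).hasFDerivAt
  have h1 : HasDerivAt (fun t : 𝕜 => F (z + t • e)) (fderiv 𝕜 F z e) 0 :=
    hF.comp_hasDerivAt (0 : 𝕜) (f := fun t : 𝕜 => z + t • e)
      (by simpa using ((hasDerivAt_id (0 : 𝕜)).smul_const e).const_add z)
  have h2 : HasDerivAt (fun t : 𝕜 => F (z + t • e))
      (∑ j, eval (fun j => (z + (0 : 𝕜) • e) j) (pderiv j f) * e j) 0 :=
    f.hasDerivAt_eval (z := fun t j => (z + t • e) j) fun j => by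
      simpa using ((hasDerivAt_id (0 : 𝕜)).mul_const (e j)).const_add (z j)
  have h3 : eval (fun j => z j) (pderiv i f) = fderiv 𝕜 F z e := by
    rw [h1.unique h2, Finset.sum_eq_single i]
    · simp [he]
    · intro j _ hj
      simp [he, hj]
    · simp
  rw [h3]
  simpa [he] using (fderiv 𝕜 F z).le_opNorm e

/-- The Łojasiewicz gradient inequality with the effective exponent for polynomials in two
variables over `ℝ` or `ℂ`. -/
theorem exists_norm_eval_pow_le_mul_norm_fderiv_pow {𝕜 : Type*} [RCLike 𝕜] {n : ℕ}
    {f : MvPolynomial (Fin 2) 𝕜} (hdeg : f.totalDegree = n + 1)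
    (hf0 : MvPolynomial.constantCoeff f = 0) :
    ∃ C : ℝ, 0 < C ∧ ∀ᶠ z : EuclideanSpace 𝕜 (Fin 2) in 𝓝 0,
      ‖MvPolynomial.eval (fun i => z i) f‖ ^ (n ^ 2) ≤
        C * ‖fderiv 𝕜 (fun z : EuclideanSpace 𝕜 (Fin 2) =>
          MvPolynomial.eval (fun i => z i) f) z‖ ^ (n ^ 2 + 1) := by
  obtain ⟨ι, hι⟩ := RCLike.exists_ringHom_complex_norm_eq 𝕜
  have hdeg' : (MvPolynomial.map ι f).totalDegree = n + 1 := by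
    rw [← hdeg, MvPolynomial.totalDegree, MvPolynomial.totalDegree,
      MvPolynomial.support_map_of_injective f ι.injective]
  obtain ⟨C, hC, hev⟩ := exists_norm_eval_pow_le_mul_pderiv_pow hdeg'
    (by rw [MvPolynomial.constantCoeff_map, hf0, map_zero])
  have hιc : Continuous ι :=
    (AddMonoidHomClass.isometry_of_norm ι hι).continuous
  have htend : Tendsto (fun z : EuclideanSpace 𝕜 (Fin 2) => (ι (z 0), ι (z 1))) (𝓝 0) (𝓝 0) := by
    have : Continuous fun z : EuclideanSpace 𝕜 (Fin 2) => (ι (z 0), ι (z 1)) := by fun_prop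
    simpa using! this.tendsto 0
  have heval : ∀ (p : MvPolynomial (Fin 2) 𝕜) (z : EuclideanSpace 𝕜 (Fin 2)),
      ‖MvPolynomial.eval ![ι (z 0), ι (z 1)] (MvPolynomial.map ι p)‖ =
        ‖MvPolynomial.eval (fun i => z i) p‖ := by
    intro p z
    have h : ![ι (z 0), ι (z 1)] = fun i => ι (z i) := by
      ext i
      fin_cases i <;> rfl
    rw [h, MvPolynomial.eval_map, ← hι, MvPolynomial.eval, MvPolynomial.coe_eval₂Hom,
      MvPolynomial.hom_eval₂, RingHom.comp_id]
  refine ⟨(C + 1) * 2 ^ (n ^ 2 + 1), by positivity, ?_⟩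
  filter_upwards [htend.eventually hev] with z hz
  simp only [MvPolynomial.pderiv_map, heval] at hz
  refine hz.trans ?_
  rw [mul_assoc, ← mul_pow, two_mul]
  gcongr
  · exact le_add_of_nonneg_right zero_le_one
  · exact f.norm_eval_pderiv_le_norm_fderiv 0 z
  · exact f.norm_eval_pderiv_le_norm_fderiv 1 z

lemma LGE_le_of_eventually_pow_le {𝕜 : Type*} [RCLike 𝕜] {E : Type*} [NormedAddCommGroup E]
    [NormedSpace 𝕜 E] {F : E → 𝕜} (hF : ContinuousAt F 0) (hF0 : F 0 = 0) {C : ℝ} (hC : 0 < C)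
    {D : ℕ} (h : ∀ᶠ z in 𝓝 0, ‖F z‖ ^ D ≤ C * ‖fderiv 𝕜 F z‖ ^ (D + 1)) :
    LGE F ≤ 1 - 1 / ((D : ℝ) + 1) := by
  refine le_of_forall_pos_le_add fun δ hδ => ?_
  have hr : (0 : ℝ) ≤ 1 - 1 / ((D : ℝ) + 1) := by
    rw [sub_nonneg, div_le_one (by positivity)]
    linarith [D.cast_nonneg (α := ℝ)]
  refine csInf_le ⟨0, fun l hl => hl.1.le⟩ ⟨by linarith, ?_⟩
  have hsmall : ∀ᶠ z in 𝓝 (0 : E), ‖F z‖ < 1 :=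
    hF.norm.eventually_lt_const (by simp [hF0])
  obtain ⟨ε, hε, hball⟩ := Metric.eventually_nhds_iff.mp (h.and hsmall)
  refine ⟨(C ^ (1 / ((D : ℝ) + 1)))⁻¹, by positivity, ε, hε, fun z hz => ?_⟩
  obtain ⟨h1, h2⟩ := hball (by rwa [dist_zero_right])
  rw [inv_mul_le_iff₀ (by positivity)]
  have hD : ((D + 1 : ℕ) : ℝ) ≠ 0 := by positivity
  calc ‖F z‖ ^ (1 - 1 / ((D : ℝ) + 1) + δ) ≤ ‖F z‖ ^ (1 - 1 / ((D : ℝ) + 1)) :=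
        Real.rpow_le_rpow_of_exponent_ge' (norm_nonneg _) h2.le hr (by linarith)
    _ = (‖F z‖ ^ D) ^ (1 / ((D : ℝ) + 1)) := by
        rw [← Real.rpow_natCast, ← Real.rpow_mul (norm_nonneg _)]
        congr 1
        field_simp
        ring
    _ ≤ (C * ‖fderiv 𝕜 F z‖ ^ (D + 1)) ^ (1 / ((D : ℝ) + 1)) := by gcongr
    _ = C ^ (1 / ((D : ℝ) + 1)) * ‖fderiv 𝕜 F z‖ := by
        rw [Real.mul_rpow hC.le (by positivity), ← Real.rpow_natCast (‖fderiv 𝕜 F z‖),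
          ← Real.rpow_mul (norm_nonneg _), Nat.cast_add_one, mul_one_div_cancel (by positivity),
          Real.rpow_one]

end

/-- a polynomial `f : 𝕂² → 𝕂` (`𝕂 = ℝ` or `ℂ`) of degree `d ≥ 1` with
`f(0) = 0` satisfies `ℒ(f) ≤ 1 - 1/((d-1)² + 1)`. -/
theorem stmt18 {𝕜 : Type*} [RCLike 𝕜] (d : ℕ) (hd : 1 ≤ d)
    (f : MvPolynomial (Fin 2) 𝕜) (hdeg : f.totalDegree = d)
    (hf0 : MvPolynomial.constantCoeff f = 0) :
    LGE (fun z : EuclideanSpace 𝕜 (Fin 2) => MvPolynomial.eval (fun i => z i) f) ≤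
      1 - 1 / (((d : ℝ) - 1) ^ 2 + 1) := by
  obtain ⟨n, rfl⟩ := Nat.exists_eq_add_of_le' hd
  obtain ⟨C, hC, h⟩ := exists_norm_eval_pow_le_mul_norm_fderiv_pow hdeg hf0
  have := LGE_le_of_eventually_pow_le (f.differentiable_eval_euclideanSpace 0).continuousAt
    ((RingHom.congr_fun MvPolynomial.eval_zero' f).trans hf0) hC h
  simpa using this
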